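/- arXiv:2307.05088 — 7 statements merged into one kernel-verified Lean document; each statement's English description precedes it below -/
import Mathlib

section
/- Let n ≥ 2 and let Ω ⊂ ℝⁿ be a bounded open set. If u₁, u₂ ∈ C²(Ω) ∩ C(Ω̄) are positive on Ω, both solve the soliton equation (SE) on Ω, and u₁ = u₂ on ∂Ω, then u₁ ≡ u₂ on Ω. -/
open Set Filter Topology

/-- Partial derivative `∂u/∂xᵢ` (Euclidean). -/
noncomputable def pd (n : ℕ) (u : EuclideanSpace ℝ (Fin n) → ℝ) (i : Fin n)
    (x : EuclideanSpace ℝ (Fin n)) : ℝ :=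
  fderiv ℝ u x (EuclideanSpace.single i 1)

/-- Second partial derivative `∂²u/∂xᵢ∂xⱼ` (Euclidean). -/
noncomputable def pd2 (n : ℕ) (u : EuclideanSpace ℝ (Fin n) → ℝ) (i j : Fin n)
    (x : EuclideanSpace ℝ (Fin n)) : ℝ :=
  fderiv ℝ (fun y => fderiv ℝ u y (EuclideanSpace.single j 1)) x (EuclideanSpace.single i 1)

/-- `|Du|²`, the squared Euclidean norm of the gradient. -/
noncomputable def gradNormSq (n : ℕ) (u : EuclideanSpace ℝ (Fin n) → ℝ)
    (x : EuclideanSpace ℝ (Fin n)) : ℝ :=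
  ∑ i, (pd n u i x) ^ 2

/-- The Euclidean Laplacian `Δu`. -/
noncomputable def lap (n : ℕ) (u : EuclideanSpace ℝ (Fin n) → ℝ)
    (x : EuclideanSpace ℝ (Fin n)) : ℝ :=
  ∑ i, pd2 n u i i x

/-- The Hessian quadratic form evaluated on the gradient, `(D²u)(Du,Du)`. -/
noncomputable def hessQuad (n : ℕ) (u : EuclideanSpace ℝ (Fin n) → ℝ)
    (x : EuclideanSpace ℝ (Fin n)) : ℝ :=
  ∑ i, ∑ j, pd2 n u i j x * pd n u i x * pd n u j x

/-- The soliton equation (SE): `Δu − (D²u)(Du,Du)/(1+|Du|²) = −(1+nu)/u²` on `Ω`,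
which is the non-divergence form of `div(Du/√(1+|Du|²)) = −(1+nu)/(u²√(1+|Du|²))`. -/
def SolvesSE (n : ℕ) (Ω : Set (EuclideanSpace ℝ (Fin n)))
    (u : EuclideanSpace ℝ (Fin n) → ℝ) : Prop :=
  ∀ x ∈ Ω, lap n u x - hessQuad n u x / (1 + gradNormSq n u x) = -(1 + n * u x) / (u x) ^ 2

/-- Second-order necessary condition at a local maximum. -/
theorem IsLocalMax.fderiv_fderiv_apply_self_nonpos {E : Type*} [NormedAddCommGroup E]
    [NormedSpace ℝ E] {w : E → ℝ} {x : E} (hmax : IsLocalMax w x) (hw : ContDiffAt ℝ 2 w x)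
    (v : E) : fderiv ℝ (fderiv ℝ w) x v v ≤ 0 := by
  by_contra! hpos
  let γ : ℝ → E := fun t => x + t • v
  have hγ (t : ℝ) : HasDerivAt γ v t := by
    simpa [γ] using ((hasDerivAt_id t).smul_const v).const_add x
  have hγ0 : γ 0 = x := by simp [γ]
  have hγc : Tendsto γ (𝓝 0) (𝓝 x) := by simpa [hγ0] using (hγ 0).continuousAt.tendsto
  have hd1 : deriv (w ∘ γ) =ᶠ[𝓝 0] fun t => fderiv ℝ w (γ t) v := by
    have hdiff : ∀ᶠ y in 𝓝 x, DifferentiableAt ℝ w y :=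
      (hw.eventually (by simp)).mono fun y hy => hy.differentiableAt (by simp)
    filter_upwards [hγc.eventually hdiff] with t ht
    exact (ht.hasFDerivAt.comp_hasDerivAt t (hγ t)).deriv
  have hd2 : deriv (deriv (w ∘ γ)) 0 = fderiv ℝ (fderiv ℝ w) x v v := by
    rw [hd1.deriv_eq]
    have h : DifferentiableAt ℝ (fderiv ℝ w) (γ 0) := by
      rw [hγ0]
      exact (hw.fderiv_right (m := 1) (by norm_num)).differentiableAt (by simp)
    have h2 := (h.hasFDerivAt.comp_hasDerivAt (0 : ℝ) (hγ 0)).clm_apply (hasDerivAt_const 0 v)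
    simpa [hγ0] using h2.deriv
  have hmax' : IsLocalMax (w ∘ γ) 0 := by
    have h := hγc.eventually hmax
    filter_upwards [h] with t ht
    simpa [hγ0] using ht
  have hcont : ContinuousAt (w ∘ γ) 0 := by
    refine ContinuousAt.comp ?_ (hγ 0).continuousAt
    rw [hγ0]
    exact hw.continuousAt
  have hmin : IsLocalMin (w ∘ γ) 0 :=
    isLocalMin_of_deriv_deriv_pos (by rwa [hd2]) hmax'.deriv_eq_zero hcont
  have hconst : (w ∘ γ) =ᶠ[𝓝 0] fun _ => (w ∘ γ) 0 := by
    filter_upwards [hmax', hmin] with t h1 h2 using le_antisymm h1 h2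
  have hzero : deriv (deriv (w ∘ γ)) 0 = 0 := by
    rw [hconst.deriv.deriv_eq]
    simp
  rw [hd2] at hzero
  exact hpos.ne' hzero

/-- A negative semidefinite bilinear form satisfies `tr B ≤ B(p,p) / (1 + |p|²)`. -/
theorem sum_diag_sub_quadratic_div_nonpos {n : ℕ}
    (B : EuclideanSpace ℝ (Fin n) →L[ℝ] EuclideanSpace ℝ (Fin n) →L[ℝ] ℝ)
    (hB : ∀ v, B v v ≤ 0) (p : Fin n → ℝ) :
    (∑ i, B (EuclideanSpace.single i 1) (EuclideanSpace.single i 1)) -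
      (∑ i, ∑ j, B (EuclideanSpace.single i 1) (EuclideanSpace.single j 1) * p i * p j) /
        (1 + ∑ i, p i ^ 2) ≤ 0 := by
  set b : Fin n → Fin n → ℝ :=
    fun i j => B (EuclideanSpace.single i 1) (EuclideanSpace.single j 1) with hb
  change (∑ i, b i i) - (∑ i, ∑ j, b i j * p i * p j) / (1 + ∑ i, p i ^ 2) ≤ 0
  have hdiag : ∑ i, b i i ≤ 0 := Finset.sum_nonpos fun i _ => hB _
  have hpair (i j : Fin n) :
      p i ^ 2 * b j j + p j ^ 2 * b i i - b i j * p i * p j - b j i * p j * p i ≤ 0 := by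
    have h := hB (p i • EuclideanSpace.single j 1 - p j • EuclideanSpace.single i 1)
    simp only [map_sub, map_smul, sub_apply, smul_apply,
      smul_eq_mul] at h
    simp only [hb]
    linarith
  have hsum := Finset.sum_nonpos fun i (_ : i ∈ Finset.univ) =>
    Finset.sum_nonpos fun j (_ : j ∈ Finset.univ) => hpair i j
  simp only [Finset.sum_sub_distrib, Finset.sum_add_distrib] at hsum
  rw [Finset.sum_comm (f := fun i j => b j i * p j * p i)] at hsum
  simp only [Finset.sum_comm (f := fun i j => p j ^ 2 * b i i), ← Finset.mul_sum] at hsum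
  rw [← Finset.sum_mul] at hsum
  have hp : 0 ≤ ∑ i, p i ^ 2 := Finset.sum_nonneg fun i _ => sq_nonneg _
  rw [sub_nonpos, le_div_iff₀ (by positivity)]
  linarith

theorem pd2_eq_fderiv_fderiv {n : ℕ} {u : EuclideanSpace ℝ (Fin n) → ℝ}
    {x : EuclideanSpace ℝ (Fin n)} (hu : ContDiffAt ℝ 2 u x) (i j : Fin n) :
    pd2 n u i j x =
      fderiv ℝ (fderiv ℝ u) x (EuclideanSpace.single i 1) (EuclideanSpace.single j 1) := by
  have h : DifferentiableAt ℝ (fderiv ℝ u) x :=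
    (hu.fderiv_right (m := 1) (by norm_num)).differentiableAt (by simp)
  rw [pd2, fderiv_clm_apply h (differentiableAt_const _)]
  simp

/-- At an interior local maximum of `u₁ - u₂`, the elliptic operators are ordered. -/
theorem elliptic_le_of_isLocalMax_sub {n : ℕ} {u₁ u₂ : EuclideanSpace ℝ (Fin n) → ℝ}
    {x : EuclideanSpace ℝ (Fin n)} (h₁ : ContDiffAt ℝ 2 u₁ x) (h₂ : ContDiffAt ℝ 2 u₂ x)
    (hmax : IsLocalMax (fun y => u₁ y - u₂ y) x) :
    lap n u₁ x - hessQuad n u₁ x / (1 + gradNormSq n u₁ x) ≤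
      lap n u₂ x - hessQuad n u₂ x / (1 + gradNormSq n u₂ x) := by
  have hd (u : EuclideanSpace ℝ (Fin n) → ℝ) (hu : ContDiffAt ℝ 2 u x) :
      ∀ᶠ y in 𝓝 x, DifferentiableAt ℝ u y :=
    (hu.eventually (by simp)).mono fun y hy => hy.differentiableAt (by simp)
  have hd' (u : EuclideanSpace ℝ (Fin n) → ℝ) (hu : ContDiffAt ℝ 2 u x) :
      DifferentiableAt ℝ (fderiv ℝ u) x :=
    (hu.fderiv_right (m := 1) (by norm_num)).differentiableAt (by simp)
  have hfd : fderiv ℝ (fun y => u₁ y - u₂ y) =ᶠ[𝓝 x]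
      fun y => fderiv ℝ u₁ y - fderiv ℝ u₂ y := by
    filter_upwards [hd u₁ h₁, hd u₂ h₂] with y hy₁ hy₂ using fderiv_fun_sub hy₁ hy₂
  have hgrad : fderiv ℝ u₁ x = fderiv ℝ u₂ x := by
    rw [← sub_eq_zero, ← hfd.eq_of_nhds]
    exact hmax.fderiv_eq_zero
  have hpd (i : Fin n) : pd n u₁ i x = pd n u₂ i x := by simp only [pd, hgrad]
  have hB (v : EuclideanSpace ℝ (Fin n)) :
      (fderiv ℝ (fderiv ℝ u₁) x - fderiv ℝ (fderiv ℝ u₂) x) v v ≤ 0 := by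
    have h := hmax.fderiv_fderiv_apply_self_nonpos (h₁.sub h₂) v
    rwa [hfd.fderiv_eq, fderiv_fun_sub (hd' u₁ h₁) (hd' u₂ h₂)] at h
  have key := sum_diag_sub_quadratic_div_nonpos _ hB fun i => pd n u₂ i x
  simp only [sub_apply, ← pd2_eq_fderiv_fderiv h₁,
    ← pd2_eq_fderiv_fderiv h₂, sub_mul, Finset.sum_sub_distrib, sub_div] at key
  simp only [lap, hessQuad, gradNormSq, hpd]
  linarith

/-- Comparison principle for the soliton equation on a bounded open set. -/
theorem SolvesSE.le_of_le_frontier {n : ℕ} {Ω : Set (EuclideanSpace ℝ (Fin n))}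
    (hΩo : IsOpen Ω) (hΩb : Bornology.IsBounded Ω) {u₁ u₂ : EuclideanSpace ℝ (Fin n) → ℝ}
    (hreg₁ : ContDiffOn ℝ 2 u₁ Ω) (hreg₂ : ContDiffOn ℝ 2 u₂ Ω)
    (hcont₁ : ContinuousOn u₁ (closure Ω)) (hcont₂ : ContinuousOn u₂ (closure Ω))
    (hpos₂ : ∀ x ∈ Ω, 0 < u₂ x) (hse₁ : SolvesSE n Ω u₁) (hse₂ : SolvesSE n Ω u₂)
    (hbd : ∀ x ∈ frontier Ω, u₁ x ≤ u₂ x) : ∀ x ∈ Ω, u₁ x ≤ u₂ x := by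
  intro z hz
  by_contra! hlt
  obtain ⟨x, hxc, hxmax⟩ := hΩb.isCompact_closure.exists_isMaxOn ⟨z, subset_closure hz⟩
    (hcont₁.sub hcont₂)
  have hx_lt : u₂ x < u₁ x := by
    have h : u₁ z - u₂ z ≤ u₁ x - u₂ x := hxmax (subset_closure hz)
    linarith
  have hx : x ∈ Ω := by
    by_contra hx
    exact hx_lt.not_ge (hbd x (hΩo.frontier_eq ▸ ⟨hxc, hx⟩))
  have hnhds : Ω ∈ 𝓝 x := hΩo.mem_nhds hx
  have hmax : IsLocalMax (fun y => u₁ y - u₂ y) x :=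
    (hxmax.on_subset subset_closure).isLocalMax hnhds
  have hle := elliptic_le_of_isLocalMax_sub (hreg₁.contDiffAt hnhds) (hreg₂.contDiffAt hnhds) hmax
  rw [hse₁ x hx, hse₂ x hx] at hle
  have ha : 0 < u₂ x := hpos₂ x hx
  have hb : 0 < u₁ x := ha.trans hx_lt
  have hf (t : ℝ) (ht : 0 < t) : -(1 + n * t) / t ^ 2 = -((1 / t) ^ 2 + n * (1 / t)) := by
    field_simp
  rw [hf _ ha, hf _ hb] at hle
  have hinv : 1 / u₁ x < 1 / u₂ x := one_div_lt_one_div_of_lt ha hx_lt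
  have hsq : (1 / u₁ x) ^ 2 < (1 / u₂ x) ^ 2 := by gcongr
  have hlin : (n : ℝ) * (1 / u₁ x) ≤ n * (1 / u₂ x) := by gcongr
  linarith

/-- uniqueness for the Dirichlet problem for the soliton equation on a
bounded open set: two positive solutions in `C²(Ω) ∩ C(Ω̄)` with the same boundary
values coincide. -/
theorem SE_uniqueness (n : ℕ) (hn : 2 ≤ n) (Ω : Set (EuclideanSpace ℝ (Fin n)))
    (hΩo : IsOpen Ω) (hΩb : Bornology.IsBounded Ω)
    (u₁ u₂ : EuclideanSpace ℝ (Fin n) → ℝ)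
    (hreg₁ : ContDiffOn ℝ 2 u₁ Ω) (hreg₂ : ContDiffOn ℝ 2 u₂ Ω)
    (hcont₁ : ContinuousOn u₁ (closure Ω)) (hcont₂ : ContinuousOn u₂ (closure Ω))
    (hpos₁ : ∀ x ∈ Ω, 0 < u₁ x) (hpos₂ : ∀ x ∈ Ω, 0 < u₂ x)
    (hse₁ : SolvesSE n Ω u₁) (hse₂ : SolvesSE n Ω u₂)
    (hbd : ∀ x ∈ frontier Ω, u₁ x = u₂ x) :
    ∀ x ∈ Ω, u₁ x = u₂ x := by
  intro x hx
  exact le_antisymm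
    (hse₁.le_of_le_frontier hΩo hΩb hreg₁ hreg₂ hcont₁ hcont₂ hpos₂ hse₂
      (fun y hy => (hbd y hy).le) x hx)
    (hse₂.le_of_le_frontier hΩo hΩb hreg₂ hreg₁ hcont₂ hcont₁ hpos₁ hse₁
      (fun y hy => (hbd y hy).ge) x hx)
end

section
/- Let n ≥ 2, let U ⊂ ℝⁿ be open, and let r : U → (0,∞) be a smooth distance function, i.e. |Dr| ≡ 1 on U. Let f(t) = −(1+nt)/t² for t > 0, let ω be a C² real function with ω ∘ r > 0 on U, and let h be a continuous function. Suppose that on U: ω'(r) < 0, ω''(r)/(ω'(r)(1+ω'(r)²)) + h(r) ≥ 0, and Δr − f(ω(r))/ω'(r) ≥ h(r) ≥ 0. Then v = ω ∘ r is a supersolution of the soliton equation: Δv − (D²v)(Dv,Dv)/(1+|Dv|²) ≤ f(v) on U. -/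
open Set Filter Topology

/-- Partial derivatives of a `C²` function are differentiable. -/
lemma ContDiffAt.differentiableAt_pd {n : ℕ} {r : EuclideanSpace ℝ (Fin n) → ℝ}
    {x : EuclideanSpace ℝ (Fin n)}
    (hr : ContDiffAt ℝ 2 r x) (j : Fin n) :
    DifferentiableAt ℝ (pd n r j) x := by
  have h1 : ContDiffAt ℝ 1 (fderiv ℝ r) x := hr.fderiv_right (by norm_num)
  exact (h1.differentiableAt one_ne_zero).clm_apply (differentiableAt_const _)

/-- Chain rule for partial derivatives. -/
lemma pd_comp {n : ℕ} {r : EuclideanSpace ℝ (Fin n) → ℝ}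
    {x : EuclideanSpace ℝ (Fin n)} {ω : ℝ → ℝ}
    (hω : DifferentiableAt ℝ ω (r x)) (hr : DifferentiableAt ℝ r x) (j : Fin n) :
    pd n (fun y => ω (r y)) j x = deriv ω (r x) * pd n r j x := by
  have h := (hω.hasDerivAt.comp_hasFDerivAt x hr.hasFDerivAt).fderiv
  simp only [Function.comp_def] at h
  simp [pd, h]

/-- Chain rule for second partial derivatives. -/
lemma pd2_comp {n : ℕ} {r : EuclideanSpace ℝ (Fin n) → ℝ}
    {x : EuclideanSpace ℝ (Fin n)} {ω : ℝ → ℝ}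
    (hω : ContDiff ℝ 2 ω) (hr : ContDiffAt ℝ 2 r x) (i j : Fin n) :
    pd2 n (fun y => ω (r y)) i j x =
      deriv (deriv ω) (r x) * pd n r i x * pd n r j x + deriv ω (r x) * pd2 n r i j x := by
  have hev : (fun y => fderiv ℝ (fun z => ω (r z)) y (EuclideanSpace.single j 1)) =ᶠ[𝓝 x]
      fun y => deriv ω (r y) * pd n r j y := by
    filter_upwards [hr.eventually (by simp)] with y hy
    exact pd_comp (hω.differentiable two_ne_zero _) (hy.differentiableAt two_ne_zero) j
  have hω1 : ContDiff ℝ 1 (deriv ω) := ContDiff.deriv' hω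
  have hd := ((hω1.differentiable one_ne_zero (r x)).hasDerivAt.comp_hasFDerivAt x
    (hr.differentiableAt two_ne_zero).hasFDerivAt).mul (hr.differentiableAt_pd j).hasFDerivAt
  have hd' : HasFDerivAt (fun y => deriv ω (r y) * pd n r j y) _ x := hd
  rw [pd2, hev.fderiv_eq, hd'.fderiv]
  change deriv ω (r x) * fderiv ℝ (pd n r j) x (EuclideanSpace.single i 1) +
    pd n r j x * (deriv (deriv ω) (r x) * pd n r i x) = _
  change deriv ω (r x) * pd2 n r i j x +
    pd n r j x * (deriv (deriv ω) (r x) * pd n r i x) = _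
  ring

/-- The gradient of a distance function lies in the kernel of its Hessian. -/
lemma sum_pd2_mul_pd_eq_zero {n : ℕ} {r : EuclideanSpace ℝ (Fin n) → ℝ}
    {x : EuclideanSpace ℝ (Fin n)}
    (hr : ContDiffAt ℝ 2 r x)
    (hdist : gradNormSq n r =ᶠ[𝓝 x] fun _ => 1) (i : Fin n) :
    ∑ j, pd2 n r i j x * pd n r j x = 0 := by
  have hd : HasFDerivAt (gradNormSq n r)
      (∑ j, (2 * pd n r j x) • fderiv ℝ (pd n r j) x) x := by
    unfold gradNormSq
    refine HasFDerivAt.fun_sum fun j _ => ?_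
    simpa using (hr.differentiableAt_pd j).hasFDerivAt.pow 2
  have h0 := hd.fderiv.symm.trans hdist.fderiv_eq
  have h1 := congrArg (fun L => L (EuclideanSpace.single i (1 : ℝ))) h0
  simp only [fderiv_fun_const, Pi.zero_apply, sum_apply,
    smul_apply, zero_apply, smul_eq_mul] at h1
  have h2 : 2 * ∑ j, pd2 n r i j x * pd n r j x = 0 := by
    rw [← h1, Finset.mul_sum]
    refine Finset.sum_congr rfl fun j _ => ?_
    change _ = 2 * pd n r j x * pd2 n r i j x
    ring
  linarith

lemma gradNormSq_comp {n : ℕ} {r : EuclideanSpace ℝ (Fin n) → ℝ}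
    {x : EuclideanSpace ℝ (Fin n)} {ω : ℝ → ℝ}
    (hω : DifferentiableAt ℝ ω (r x)) (hr : DifferentiableAt ℝ r x) :
    gradNormSq n (fun y => ω (r y)) x = deriv ω (r x) ^ 2 * gradNormSq n r x := by
  simp only [gradNormSq, pd_comp hω hr, mul_pow, Finset.mul_sum]

lemma lap_comp {n : ℕ} {r : EuclideanSpace ℝ (Fin n) → ℝ}
    {x : EuclideanSpace ℝ (Fin n)} {ω : ℝ → ℝ}
    (hω : ContDiff ℝ 2 ω) (hr : ContDiffAt ℝ 2 r x) :
    lap n (fun y => ω (r y)) x =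
      deriv (deriv ω) (r x) * gradNormSq n r x + deriv ω (r x) * lap n r x := by
  simp only [lap, gradNormSq, pd2_comp hω hr, Finset.mul_sum, ← Finset.sum_add_distrib]
  exact Finset.sum_congr rfl fun i _ => by ring

lemma hessQuad_comp {n : ℕ} {r : EuclideanSpace ℝ (Fin n) → ℝ}
    {x : EuclideanSpace ℝ (Fin n)} {ω : ℝ → ℝ}
    (hω : ContDiff ℝ 2 ω) (hr : ContDiffAt ℝ 2 r x) :
    hessQuad n (fun y => ω (r y)) x =
      deriv ω (r x) ^ 2 * deriv (deriv ω) (r x) * gradNormSq n r x ^ 2 +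
        deriv ω (r x) ^ 3 * hessQuad n r x := by
  have hω1 := hω.differentiable two_ne_zero (r x)
  have hr1 := hr.differentiableAt two_ne_zero
  have hsq : gradNormSq n r x ^ 2 = ∑ i, ∑ j, pd n r i x ^ 2 * pd n r j x ^ 2 := by
    rw [sq, gradNormSq, Finset.sum_mul_sum]
  simp only [hsq, hessQuad, pd2_comp hω hr, pd_comp hω1 hr1, Finset.mul_sum,
    ← Finset.sum_add_distrib]
  exact Finset.sum_congr rfl fun i _ => Finset.sum_congr rfl fun j _ => by ring

lemma hessQuad_eq_zero {n : ℕ} {r : EuclideanSpace ℝ (Fin n) → ℝ}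
    {x : EuclideanSpace ℝ (Fin n)}
    (hr : ContDiffAt ℝ 2 r x)
    (hdist : gradNormSq n r =ᶠ[𝓝 x] fun _ => 1) : hessQuad n r x = 0 := by
  refine Finset.sum_eq_zero fun i _ => ?_
  have h := sum_pd2_mul_pd_eq_zero hr hdist i
  calc ∑ j, pd2 n r i j x * pd n r i x * pd n r j x
      = pd n r i x * ∑ j, pd2 n r i j x * pd n r j x := by
        rw [Finset.mul_sum]
        exact Finset.sum_congr rfl fun j _ => by ring
    _ = 0 := by rw [h, mul_zero]

/-- supersolution criterion (Lemma 5.1).  If `r` is a smooth distance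
function (`|Dr| ≡ 1`) on an open set `U`, `ω` is `C²` with `ω ∘ r > 0` on `U`, `h` is
continuous, and on `U` one has `ω'(r) < 0`, `ω''(r)/(ω'(r)(1+ω'(r)²)) + h(r) ≥ 0` and
`Δr − f(ω(r))/ω'(r) ≥ h(r) ≥ 0` with `f(t) = −(1+nt)/t²`, then `v = ω ∘ r` is a
supersolution of the soliton equation on `U`. -/
theorem SE_supersolution_criterion (n : ℕ) (hn : 2 ≤ n)
    (U : Set (EuclideanSpace ℝ (Fin n))) (hU : IsOpen U)
    (r : EuclideanSpace ℝ (Fin n) → ℝ)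
    (hr_smooth : ContDiffOn ℝ (⊤ : ℕ∞) r U)
    (hr_pos : ∀ x ∈ U, 0 < r x)
    (hr_dist : ∀ x ∈ U, gradNormSq n r x = 1)
    (ω : ℝ → ℝ) (hω : ContDiff ℝ 2 ω)
    (hωr_pos : ∀ x ∈ U, 0 < ω (r x))
    (h : ℝ → ℝ) (hh : Continuous h)
    (hω' : ∀ x ∈ U, deriv ω (r x) < 0)
    (hω'' : ∀ x ∈ U,
      0 ≤ deriv (deriv ω) (r x) / (deriv ω (r x) * (1 + (deriv ω (r x)) ^ 2)) + h (r x))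
    (hlapr : ∀ x ∈ U,
      h (r x) ≤ lap n r x - (-(1 + n * ω (r x)) / (ω (r x)) ^ 2) / deriv ω (r x))
    (hh_nonneg : ∀ x ∈ U, 0 ≤ h (r x)) :
    ∀ x ∈ U,
      lap n (fun y => ω (r y)) x -
          hessQuad n (fun y => ω (r y)) x / (1 + gradNormSq n (fun y => ω (r y)) x) ≤
        -(1 + n * ω (r x)) / (ω (r x)) ^ 2 := by
  intro x hx
  have hUx := hU.mem_nhds hx
  have hr : ContDiffAt ℝ 2 r x := (hr_smooth.contDiffAt hUx).of_le 
    (WithTop.coe_le_coe.2 (le_top : (2 : ℕ∞) ≤ ⊤))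
  have hdist : gradNormSq n r =ᶠ[𝓝 x] fun _ => 1 := by
    filter_upwards [hUx] with y hy using hr_dist y hy
  have hneg := hω' x hx
  have h1 := hω'' x hx
  have h2 := hlapr x hx
  rw [lap_comp hω hr, hessQuad_comp hω hr, hessQuad_eq_zero hr hdist,
    gradNormSq_comp (hω.differentiable two_ne_zero _) (hr.differentiableAt two_ne_zero),
    hr_dist x hx]
  generalize -(1 + (n : ℝ) * ω (r x)) / ω (r x) ^ 2 = F at *
  generalize deriv (deriv ω) (r x) = b at *
  generalize deriv ω (r x) = a at *
  have ha : a ≠ 0 := hneg.ne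
  have hpos : 1 + a ^ 2 ≠ 0 := by positivity
  have e1 : a * (b / (a * (1 + a ^ 2))) = b / (1 + a ^ 2) := by field_simp
  have e2 : a * (F / a) = F := by field_simp
  have e3 : b * 1 + a * lap n r x - (a ^ 2 * b * 1 ^ 2 + a ^ 3 * 0) / (1 + a ^ 2 * 1) =
      a * lap n r x + b / (1 + a ^ 2) := by
    field_simp
    ring
  have m1 := mul_le_mul_of_nonpos_left h1 hneg.le
  have m2 := mul_le_mul_of_nonpos_left h2 hneg.le
  rw [mul_add, e1] at m1
  rw [mul_sub, e2] at m2
  rw [e3]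
  linarith
end

section
/- Let n ≥ 2, let Ω ⊂ ℝⁿ be a bounded open set, let y ∈ ∂Ω, and suppose there exist a₁ > 0 and θ > 0 such that the distance function r(x) = dist(x, ∂Ω) is C² on Ω̄ ∩ B_{a₁}(y) and satisfies Δr ≥ 2θ on Ω ∩ B_{a₁}(y). Let m > 0. Then for every ε > 0 there exists a₀ ∈ (0, a₁] (depending only on Ω, θ, n, m and ε) such that every function u ∈ C²(Ω) ∩ C(Ω̄) with u ≥ m on Ω solving the soliton equation (SE) on Ω satisfies, for all a ∈ (0, a₀), sup_{Ω ∩ B_a(y)} u ≤ ε + sup_{Ω ∩ ∂B_a(y)} u. -/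
open Set Filter Topology

theorem nonpos_of_isLocalMax {g g' : ℝ → ℝ} {c t₀ : ℝ}
    (hg : ∀ᶠ t in 𝓝 t₀, HasDerivAt g (g' t) t) (hg' : HasDerivAt g' c t₀)
    (hmax : IsLocalMax g t₀) : c ≤ 0 := by
  by_contra! hc
  have hd : deriv g =ᶠ[𝓝 t₀] g' := hg.mono fun t ht => ht.deriv
  have hdd : deriv (deriv g) t₀ = c := by rw [hd.deriv_eq, hg'.deriv]
  have hmin : IsLocalMin g t₀ :=
    isLocalMin_of_deriv_deriv_pos (hdd ▸ hc) hmax.deriv_eq_zero hg.self_of_nhds.continuousAt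
  have hconst : g =ᶠ[𝓝 t₀] fun _ => g t₀ := by
    filter_upwards [hmin, hmax] with t h1 h2 using le_antisymm h2 h1
  have h0 : deriv g =ᶠ[𝓝 t₀] fun _ => 0 := by
    simpa using hconst.deriv
  have : deriv (deriv g) t₀ = 0 := by simpa using h0.deriv_eq
  linarith

section

variable {E : Type*} [NormedAddCommGroup E] [NormedSpace ℝ E]

theorem hasDerivAt_comp_line {f : E → ℝ} {x d : E} {t : ℝ}
    (hf : DifferentiableAt ℝ f (x + t • d)) :
    HasDerivAt (fun τ : ℝ => f (x + τ • d)) (fderiv ℝ f (x + t • d) d) t := by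
  have hl : HasDerivAt (fun τ : ℝ => x + τ • d) d t := by
    simpa using ((hasDerivAt_id t).smul_const d).const_add x
  exact hf.hasFDerivAt.comp_hasDerivAt t hl

theorem fderiv_fderiv_apply {f : E → ℝ} {x : E} (hf : ContDiffAt ℝ 2 f x) (v w : E) :
    fderiv ℝ (fun z => fderiv ℝ f z v) x w = fderiv ℝ (fderiv ℝ f) x w v := by
  have h1 : DifferentiableAt ℝ (fderiv ℝ f) x :=
    (hf.fderiv_right (m := 1) (by norm_num)).differentiableAt (by norm_num)
  rw [fderiv_clm_apply h1 (differentiableAt_const v)]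
  simp

theorem hasDerivAt_fderiv_comp_line {f : E → ℝ} {x : E} (hf : ContDiffAt ℝ 2 f x) (d : E) :
    HasDerivAt (fun τ : ℝ => fderiv ℝ f (x + τ • d) d) (fderiv ℝ (fderiv ℝ f) x d d) 0 := by
  have h1 : DifferentiableAt ℝ (fderiv ℝ f) x :=
    (hf.fderiv_right (m := 1) (by norm_num)).differentiableAt (by norm_num)
  have h2 : DifferentiableAt ℝ (fun z => fderiv ℝ f z d) x :=
    h1.clm_apply (differentiableAt_const d)
  have h3 := hasDerivAt_comp_line (x := x) (d := d) (t := 0) (by simpa using h2)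
  rwa [zero_smul, add_zero, fderiv_fderiv_apply hf] at h3

theorem eventually_differentiableAt_line {f : E → ℝ} {x : E} (hf : ContDiffAt ℝ 2 f x) (d : E) :
    ∀ᶠ t in 𝓝 (0 : ℝ), DifferentiableAt ℝ f (x + t • d) := by
  have h1 : ∀ᶠ z in 𝓝 x, DifferentiableAt ℝ f z :=
    (hf.eventually (by simp)).mono fun z hz => hz.differentiableAt (by norm_num)
  have hc : Tendsto (fun t : ℝ => x + t • d) (𝓝 0) (𝓝 x) := by
    have : Continuous fun t : ℝ => x + t • d := by fun_prop
    simpa using this.tendsto 0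
  exact hc.eventually h1

/-- First and second order conditions at a local maximum of `f - ψ ∘ r`. -/
theorem IsLocalMax.fderiv_conditions {f r : E → ℝ} {ψ ψ' : ℝ → ℝ} {c : ℝ} {x : E}
    (hf : ContDiffAt ℝ 2 f x) (hr : ContDiffAt ℝ 2 r x)
    (hψ : ∀ᶠ s in 𝓝 (r x), HasDerivAt ψ (ψ' s) s) (hψ' : HasDerivAt ψ' c (r x))
    (hmax : IsLocalMax (fun z => f z - ψ (r z)) x) (d : E) :
    fderiv ℝ f x d = ψ' (r x) * fderiv ℝ r x d ∧
    fderiv ℝ (fderiv ℝ f) x d d ≤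
      ψ' (r x) * fderiv ℝ (fderiv ℝ r) x d d + c * (fderiv ℝ r x d) ^ 2 := by
  have hcl : Tendsto (fun t : ℝ => x + t • d) (𝓝 0) (𝓝 x) := by
    have : Continuous fun t : ℝ => x + t • d := by fun_prop
    simpa using this.tendsto 0
  have hmax' : IsLocalMax (fun t : ℝ => f (x + t • d) - ψ (r (x + t • d))) 0 := by
    have := hcl.eventually hmax
    simpa [IsLocalMax, IsMaxFilter] using this
  have hψl := (hr.continuousAt.tendsto.comp hcl).eventually hψ
  have hg : ∀ᶠ t in 𝓝 (0 : ℝ), HasDerivAt (fun t : ℝ => f (x + t • d) - ψ (r (x + t • d)))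
      (fderiv ℝ f (x + t • d) d - ψ' (r (x + t • d)) * fderiv ℝ r (x + t • d) d) t := by
    filter_upwards [eventually_differentiableAt_line hf d, eventually_differentiableAt_line hr d,
      hψl] with t h1 h2 h3
    exact (hasDerivAt_comp_line h1).sub
      (HasDerivAt.comp (h₂ := ψ) t h3 (hasDerivAt_comp_line h2))
  have hr1 : HasDerivAt (fun τ : ℝ => r (x + τ • d)) (fderiv ℝ r x d) 0 := by
    simpa using hasDerivAt_comp_line (eventually_differentiableAt_line hr d).self_of_nhds
  have hψ1 : HasDerivAt (fun τ : ℝ => ψ' (r (x + τ • d))) (c * fderiv ℝ r x d) 0 := by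
    have : HasDerivAt ψ' c (r (x + (0 : ℝ) • d)) := by simpa using hψ'
    exact HasDerivAt.comp (h₂ := ψ') (0 : ℝ) this hr1
  have hg' := (hasDerivAt_fderiv_comp_line hf d).sub
    (hψ1.mul (hasDerivAt_fderiv_comp_line hr d))
  have h1 := hmax'.hasDerivAt_eq_zero hg.self_of_nhds
  have h2 := nonpos_of_isLocalMax hg hg' hmax'
  simp only [zero_smul, add_zero] at h1 h2
  constructor <;> linarith

end

theorem eq_sum_smul_single {n : ℕ} (p : EuclideanSpace ℝ (Fin n)) :
    p = ∑ i, p i • EuclideanSpace.single i (1 : ℝ) := by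
  simpa using ((EuclideanSpace.basisFun (Fin n) ℝ).sum_repr p).symm

/-- The trace of a bilinear form after conjugation by `I - s p pᵀ`. -/
theorem sum_bilin_sub_smul {n : ℕ}
    (H : EuclideanSpace ℝ (Fin n) →L[ℝ] EuclideanSpace ℝ (Fin n) →L[ℝ] ℝ)
    (p : EuclideanSpace ℝ (Fin n)) (s : ℝ) :
    ∑ i, H (EuclideanSpace.single i 1 - (s * p i) • p)
        (EuclideanSpace.single i 1 - (s * p i) • p) =
      ∑ i, H (EuclideanSpace.single i 1) (EuclideanSpace.single i 1)
        - (2 * s - s ^ 2 * ‖p‖ ^ 2) * H p p := by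
  have hp := eq_sum_smul_single p
  have h1 : ∑ i, p i * H (EuclideanSpace.single i 1) p = H p p := by
    conv_rhs => rw [show H p = H (∑ i, p i • EuclideanSpace.single i (1 : ℝ)) by rw [← hp]]
    simp
  have h2 : ∑ i, p i * H p (EuclideanSpace.single i 1) = H p p := by
    conv_rhs => rw [show H p p = H p (∑ i, p i • EuclideanSpace.single i (1 : ℝ)) by rw [← hp]]
    simp
  have h3 : ∀ i, H (EuclideanSpace.single i 1 - (s * p i) • p)
        (EuclideanSpace.single i 1 - (s * p i) • p) =
      H (EuclideanSpace.single i 1) (EuclideanSpace.single i 1)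
        - s * (p i * H (EuclideanSpace.single i 1) p)
        - s * (p i * H p (EuclideanSpace.single i 1))
        + s ^ 2 * (p i ^ 2) * H p p := by
    intro i
    simp only [map_sub, map_smul, sub_apply, smul_apply,
      smul_eq_mul]
    ring
  simp_rw [h3]
  rw [Finset.sum_add_distrib, Finset.sum_sub_distrib, Finset.sum_sub_distrib, ← Finset.mul_sum,
    ← Finset.mul_sum, h1, h2, ← Finset.sum_mul, ← Finset.mul_sum, ← EuclideanSpace.real_norm_sq_eq]
  ring

/-- At a point off a closed set `s`, the distance to `s` grows at unit speed away from a nearest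
point of `s`, and its second derivative in that direction is nonpositive. -/
theorem exists_unit_infDist_derivs {n : ℕ} {s : Set (EuclideanSpace ℝ (Fin n))}
    (hs : IsClosed s) (hne : s.Nonempty) {x : EuclideanSpace ℝ (Fin n)} (hx : x ∉ s)
    (hr : ContDiffAt ℝ 2 (fun z => Metric.infDist z s) x) :
    ∃ e : EuclideanSpace ℝ (Fin n), ‖e‖ = 1 ∧
      (∀ v, fderiv ℝ (fun z => Metric.infDist z s) x v = inner ℝ e v) ∧
      fderiv ℝ (fderiv ℝ (fun z => Metric.infDist z s)) x e e ≤ 0 := by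
  obtain ⟨z, hz, hxz⟩ := hs.exists_infDist_eq_dist hne x
  have hpos : 0 < dist x z := hxz ▸ (hs.notMem_iff_infDist_pos hne).1 hx
  set ρ := dist x z with hρ
  have hρn : ‖x - z‖ = ρ := (dist_eq_norm x z).symm
  set e : EuclideanSpace ℝ (Fin n) := ρ⁻¹ • (x - z) with he
  have hen : ‖e‖ = 1 := by
    rw [he, norm_smul, hρn, norm_inv, Real.norm_of_nonneg hpos.le, inv_mul_cancel₀ hpos.ne']
  have hxe : x - z = ρ • e := by rw [he, smul_inv_smul₀ hpos.ne']
  have hmax : IsLocalMax (fun t : ℝ => Metric.infDist (x + t • e) s - t) 0 := by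
    filter_upwards [lt_mem_nhds (show -ρ < (0 : ℝ) by linarith)] with t ht
    have h1 : Metric.infDist (x + t • e) s ≤ dist (x + t • e) z :=
      Metric.infDist_le_dist_of_mem hz
    have h2 : dist (x + t • e) z = ρ + t := by
      rw [dist_eq_norm, show x + t • e - z = (ρ + t) • e by rw [add_smul, ← hxe]; abel,
        norm_smul, hen, mul_one, Real.norm_of_nonneg (by linarith)]
    simp only [zero_smul, add_zero, hxz]
    linarith
  have hg : ∀ᶠ t in 𝓝 (0 : ℝ), HasDerivAt (fun t : ℝ => Metric.infDist (x + t • e) s - t)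
      (fderiv ℝ (fun z => Metric.infDist z s) (x + t • e) e - 1) t := by
    filter_upwards [eventually_differentiableAt_line hr e] with t h1
    exact (hasDerivAt_comp_line h1).sub (hasDerivAt_id t)
  have hg' := (hasDerivAt_fderiv_comp_line hr e).sub_const 1
  have h1 := hmax.hasDerivAt_eq_zero hg.self_of_nhds
  have h2 := nonpos_of_isLocalMax hg hg' hmax
  simp only [zero_smul, add_zero] at h1
  set L := fderiv ℝ (fun z => Metric.infDist z s) x with hL
  have hLn : ‖L‖ ≤ 1 := by
    simpa using norm_fderiv_le_of_lipschitz ℝ (Metric.lipschitz_infDist_pt s) (x₀ := x)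
  set ν := (InnerProductSpace.toDual ℝ (EuclideanSpace ℝ (Fin n))).symm L with hν
  have hνL : ∀ v, inner ℝ ν v = L v := fun v => InnerProductSpace.toDual_symm_apply
  have hνn : ‖ν‖ ≤ 1 := by rw [hν, LinearIsometryEquiv.norm_map]; exact hLn
  have hνe : ν = e := by
    have h3 := norm_sub_sq_real ν e
    rw [hνL, hen] at h3
    have h4 : ‖ν - e‖ ^ 2 ≤ 0 := by nlinarith [norm_nonneg ν]
    have h5 : ‖ν - e‖ = 0 := by nlinarith [norm_nonneg (ν - e)]
    exact sub_eq_zero.1 (norm_eq_zero.1 h5)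
  exact ⟨e, hen, fun v => by rw [← hνL, hνe], h2⟩

theorem hessQuad_eq {n : ℕ} {u : EuclideanSpace ℝ (Fin n) → ℝ} {x p : EuclideanSpace ℝ (Fin n)}
    (hu : ContDiffAt ℝ 2 u x) (hp : ∀ i, pd n u i x = p i) :
    hessQuad n u x = fderiv ℝ (fderiv ℝ u) x p p := by
  have hp' := eq_sum_smul_single p
  have h1 : fderiv ℝ (fderiv ℝ u) x p p = fderiv ℝ (fderiv ℝ u) x
      (∑ i, p i • EuclideanSpace.single i (1 : ℝ))
      (∑ i, p i • EuclideanSpace.single i (1 : ℝ)) := by rw [← hp']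
  rw [h1, hessQuad]
  simp only [map_sum, map_smul, sum_apply, smul_apply, smul_eq_mul, hp, pd2,
    fderiv_fderiv_apply hu, Finset.mul_sum]
  rw [Finset.sum_comm]
  exact Finset.sum_congr rfl fun i _ => Finset.sum_congr rfl fun j _ => by ring

theorem lap_eq {n : ℕ} {u : EuclideanSpace ℝ (Fin n) → ℝ} {x : EuclideanSpace ℝ (Fin n)}
    (hu : ContDiffAt ℝ 2 u x) :
    lap n u x = ∑ i, fderiv ℝ (fderiv ℝ u) x (EuclideanSpace.single i 1)
      (EuclideanSpace.single i 1) := by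
  simp only [lap, pd2, fderiv_fderiv_apply hu]

/-- The mean curvature operator of `u` at a local maximum of `u - ψ ∘ r`, where `r` behaves like a
distance function and `ψ' = -b ≤ 0`. -/
theorem meanCurvature_le_of_isLocalMax {n : ℕ} {u r : EuclideanSpace ℝ (Fin n) → ℝ}
    {ψ ψ' : ℝ → ℝ} {b c : ℝ} {x e : EuclideanSpace ℝ (Fin n)}
    (hu : ContDiffAt ℝ 2 u x) (hr : ContDiffAt ℝ 2 r x)
    (hψ : ∀ᶠ s in 𝓝 (r x), HasDerivAt ψ (ψ' s) s) (hψ' : HasDerivAt ψ' c (r x))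
    (hmax : IsLocalMax (fun z => u z - ψ (r z)) x)
    (hb : 0 ≤ b) (hψb : ψ' (r x) = -b) (he : ‖e‖ = 1)
    (hre : ∀ v, fderiv ℝ r x v = inner ℝ e v) (hree : fderiv ℝ (fderiv ℝ r) x e e ≤ 0) :
    lap n u x - hessQuad n u x / (1 + gradNormSq n u x) ≤ -b * lap n r x + c / (1 + b ^ 2) := by
  have key := fun d => IsLocalMax.fderiv_conditions hu hr hψ hψ' hmax d
  rw [hψb] at key
  set p : EuclideanSpace ℝ (Fin n) := (-b) • e with hp
  have hpd : ∀ i, pd n u i x = p i := fun i => by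
    rw [pd, (key _).1, hre, EuclideanSpace.inner_single_right]
    simp [hp]
  have hpn : ‖p‖ ^ 2 = b ^ 2 := by rw [hp, norm_smul, he]; simp
  have hgn : gradNormSq n u x = b ^ 2 := by
    rw [gradNormSq, ← hpn, EuclideanSpace.real_norm_sq_eq]
    simp only [hpd]
  rw [hgn, hessQuad_eq hu hpd, lap_eq hu, lap_eq hr]
  set q := √(1 + b ^ 2) with hq
  have hq2 : q ^ 2 = 1 + b ^ 2 := Real.sq_sqrt (by positivity)
  have hqpos : 0 < q := Real.sqrt_pos.2 (by positivity)
  set s := 1 / (q * (q + 1)) with hs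
  have hb2 : b ^ 2 = q ^ 2 - 1 := by linarith
  have hs1 : 2 * s - s ^ 2 * ‖p‖ ^ 2 = 1 / (1 + b ^ 2) := by
    rw [hpn, ← hq2, hb2, hs]; field_simp; ring
  have hs2 : 1 - s * b ^ 2 = 1 / q := by
    rw [hb2, hs]; field_simp; ring
  have hsum := Finset.sum_le_sum fun (i : Fin n) (_ : i ∈ Finset.univ) =>
    (key (EuclideanSpace.single i 1 - (s * p i) • p)).2
  rw [Finset.sum_add_distrib, ← Finset.mul_sum, ← Finset.mul_sum, sum_bilin_sub_smul,
    sum_bilin_sub_smul, hs1] at hsum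
  have hlin : ∀ i, fderiv ℝ r x (EuclideanSpace.single i 1 - (s * p i) • p) = e i * (1 / q) := by
    intro i
    rw [hre, inner_sub_right, EuclideanSpace.inner_single_right, hp, inner_smul_right,
      inner_smul_right, real_inner_self_eq_norm_sq, he, ← hs2]
    simp
    ring
  have hlinsum : ∑ i, (fderiv ℝ r x (EuclideanSpace.single i 1 - (s * p i) • p)) ^ 2
      = 1 / (1 + b ^ 2) := by
    simp only [hlin, mul_pow]
    rw [← Finset.sum_mul, ← EuclideanSpace.real_norm_sq_eq, he, ← hq2]
    simp
  rw [hlinsum] at hsum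
  have hrp : fderiv ℝ (fderiv ℝ r) x p p ≤ 0 := by
    simp only [hp, map_smul, smul_apply, smul_eq_mul]
    nlinarith [mul_nonneg hb hb]
  have h1 : 0 ≤ b * (1 / (1 + b ^ 2) * -fderiv ℝ (fderiv ℝ r) x p p) :=
    mul_nonneg hb (mul_nonneg (by positivity) (by linarith))
  rw [div_eq_mul_one_div c, div_eq_mul_one_div (fderiv ℝ (fderiv ℝ u) x p p)]
  nlinarith

/-- The soliton right-hand side is bounded where `u ≥ m > 0`. -/
theorem soliton_rhs_ge {n : ℕ} {m t : ℝ} (hm : 0 < m) (ht : m ≤ t) :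
    -((1 + n * m) / m ^ 2) ≤ -(1 + n * t) / t ^ 2 := by
  have ht0 : 0 < t := hm.trans_le ht
  rw [neg_div, neg_le_neg_iff]
  have h1 : (1 + n * t) / t ^ 2 = (1 / t) ^ 2 + n * (1 / t) := by field_simp
  have h2 : (1 + n * m) / m ^ 2 = (1 / m) ^ 2 + n * (1 / m) := by field_simp
  rw [h1, h2]
  have h3 : 1 / t ≤ 1 / m := one_div_le_one_div_of_le hm ht
  gcongr

theorem hasDerivAt_sqrt_profile (B K : ℝ) {δ s : ℝ} (hs : δ < s) :
    HasDerivAt (fun s => B - 2 * K * √(s - δ)) (-(K / √(s - δ))) s := by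
  have h0 : 0 < √(s - δ) := Real.sqrt_pos.2 (by linarith)
  have h := ((((hasDerivAt_id s).sub_const δ).sqrt
    (by simpa using (sub_pos.2 hs).ne')).const_mul (2 * K)).const_sub B
  refine h.congr_deriv ?_
  simp only [id]
  field_simp

theorem hasDerivAt_deriv_sqrt_profile (K : ℝ) {δ s : ℝ} (hs : δ < s) :
    HasDerivAt (fun s => -(K / √(s - δ))) (K / (2 * √(s - δ) ^ 3)) s := by
  have h0 : 0 < √(s - δ) := Real.sqrt_pos.2 (by linarith)
  have h := (((hasDerivAt_const s K).div (((hasDerivAt_id s).sub_const δ).sqrt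
    (by simpa using (sub_pos.2 hs).ne')) (by simpa using h0.ne')).neg)
  refine h.congr_deriv ?_
  simp only [id]
  field_simp
  ring

/-- A differentiable function decreases more slowly than the square root of a function with unit
slope. -/
theorem eventually_lt_add_sqrt {g ρ : ℝ → ℝ} {g' δ K : ℝ} (hK : 0 < K)
    (hg : HasDerivAt g g' 0) (hρ : HasDerivAt ρ 1 0) (hρ0 : ρ 0 = δ) :
    ∀ᶠ t in 𝓝[>] (0 : ℝ), δ ≤ ρ t ∧ g 0 < g t + K * √(ρ t - δ) := by
  have h1 : ∀ᶠ t in 𝓝[>] (0 : ℝ), 1 / 2 < slope ρ 0 t :=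
    ((hasDerivAt_iff_tendsto_slope.1 hρ).mono_left
      (nhdsWithin_mono _ fun t (ht : 0 < t) => ht.ne')).eventually (lt_mem_nhds (by norm_num))
  have h2 : ∀ᶠ t in 𝓝[>] (0 : ℝ), g' - 1 < slope g 0 t :=
    ((hasDerivAt_iff_tendsto_slope.1 hg).mono_left
      (nhdsWithin_mono _ fun t (ht : 0 < t) => ht.ne')).eventually (lt_mem_nhds (by linarith))
  set A := |g' - 1| + 1 with hA
  have hApos : 0 < A := by positivity
  have h3 : ∀ᶠ t in 𝓝[>] (0 : ℝ), t < K ^ 2 / (2 * A ^ 2) :=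
    nhdsWithin_le_nhds (gt_mem_nhds (by positivity))
  filter_upwards [h1, h2, h3, self_mem_nhdsWithin] with t h1 h2 h3 (ht : 0 < t)
  rw [slope_def_field, sub_zero, lt_div_iff₀ ht, hρ0] at h1
  rw [slope_def_field, sub_zero, lt_div_iff₀ ht] at h2
  refine ⟨by linarith, ?_⟩
  have h4 : -A < g' - 1 := by have := neg_abs_le (g' - 1); linarith
  have h5 : A * t < K * √(ρ t - δ) := by
    have h6 : A * t / K < √(ρ t - δ) := by
      apply Real.lt_sqrt_of_sq_lt
      refine lt_trans ?_ (show 1 / 2 * t < ρ t - δ from h1)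
      rw [lt_div_iff₀ (by positivity)] at h3
      rw [div_pow, div_lt_iff₀ (by positivity)]
      nlinarith
    rw [div_lt_iff₀ hK] at h6
    linarith
  nlinarith

/-- estimate near a boundary point where the distance function to the
boundary is `C²` with `Δ dist(·,∂Ω) ≥ 2θ > 0` (Lemma 5.3): for every `ε > 0` there is
`a₀ ∈ (0,a₁]` such that every solution `u ≥ m > 0` of (SE) satisfies
`sup_{Ω ∩ B_a(y)} u ≤ ε + sup_{Ω ∩ ∂B_a(y)} u` for all `a ∈ (0,a₀)`. -/
theorem SE_estimate_near_concave_point (n : ℕ) (hn : 2 ≤ n)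
    (Ω : Set (EuclideanSpace ℝ (Fin n)))
    (hΩo : IsOpen Ω) (hΩb : Bornology.IsBounded Ω)
    (y : EuclideanSpace ℝ (Fin n)) (hy : y ∈ frontier Ω)
    (a₁ θ : ℝ) (ha₁ : 0 < a₁) (hθ : 0 < θ)
    (hr_reg : ContDiffOn ℝ 2 (fun x => Metric.infDist x (frontier Ω))
      (closure Ω ∩ Metric.ball y a₁))
    (hr_lap : ∀ x ∈ Ω ∩ Metric.ball y a₁,
      2 * θ ≤ lap n (fun z => Metric.infDist z (frontier Ω)) x)
    (m : ℝ) (hm : 0 < m) :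
    ∀ ε : ℝ, 0 < ε → ∃ a₀ : ℝ, 0 < a₀ ∧ a₀ ≤ a₁ ∧
      ∀ u : EuclideanSpace ℝ (Fin n) → ℝ,
        ContDiffOn ℝ 2 u Ω → ContinuousOn u (closure Ω) →
        (∀ x ∈ Ω, m ≤ u x) → SolvesSE n Ω u →
        ∀ a : ℝ, 0 < a → a < a₀ →
          ∀ x ∈ Ω ∩ Metric.ball y a,
            u x ≤ ε + sSup (u '' (Ω ∩ Metric.sphere y a)) := by
  intro ε hε
  set κ := √θ with hκ
  have hκpos : 0 < κ := Real.sqrt_pos.2 hθ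
  have hκ2 : κ ^ 2 = θ := Real.sq_sqrt hθ.le
  set C := (1 + n * m) / m ^ 2 with hC
  have hCpos : 0 < C := by positivity
  set η := min (κ / C) (ε * κ / 2) with hη
  have hηpos : 0 < η := lt_min (by positivity) (by positivity)
  refine ⟨min a₁ (η ^ 2), lt_min ha₁ (by positivity), min_le_left _ _, ?_⟩
  intro u hu huc hum hse a ha haa x ⟨hxΩ, hxa⟩
  have haa₁ : a < a₁ := haa.trans_le (min_le_left _ _)
  have hsa : √a < η := (Real.sqrt_lt' hηpos).2 (haa.trans_le (min_le_right _ _))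
  have hsaC : C * √a < κ := by
    have := hsa.trans_le (min_le_left _ _)
    rw [lt_div_iff₀ hCpos] at this
    linarith
  set K := 1 / κ with hK
  have hKpos : 0 < K := by positivity
  have hsaε : 2 * K * √a < ε := by
    have := hsa.trans_le (min_le_right _ _)
    rw [hK, mul_one_div, div_mul_eq_mul_div, div_lt_iff₀ hκpos]
    linarith
  set r : EuclideanSpace ℝ (Fin n) → ℝ := fun z => Metric.infDist z (frontier Ω) with hr
  have hrc : Continuous r := Metric.continuous_infDist_pt _
  have hFc : IsClosed (frontier Ω) := isClosed_frontier
  have hFne : (frontier Ω).Nonempty := ⟨y, hy⟩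
  have hF : ∀ z ∈ Ω, z ∉ frontier Ω := fun z hz hzf => by
    rw [hΩo.frontier_eq] at hzf
    exact hzf.2 hz
  have hrpos : ∀ z ∈ Ω, 0 < r z := fun z hz =>
    (hFc.notMem_iff_infDist_pos hFne).1 (hF z hz)
  have hrle : ∀ z, r z ≤ dist z y := fun z => Metric.infDist_le_dist_of_mem hy
  set M := sSup (u '' (Ω ∩ Metric.sphere y a)) with hM
  have hbdd : BddAbove (u '' (Ω ∩ Metric.sphere y a)) :=
    ((hΩb.isCompact_closure.image_of_continuousOn huc).bddAbove).mono
      (image_mono (inter_subset_left.trans subset_closure))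
  set δ := r x / 2 with hδ
  have hδpos : 0 < δ := half_pos (hrpos x hxΩ)
  set S : Set (EuclideanSpace ℝ (Fin n)) :=
    closure Ω ∩ (Metric.closedBall y a ∩ {z | δ ≤ r z}) with hS
  have hScomp : IsCompact S :=
    hΩb.isCompact_closure.inter_right
      (Metric.isClosed_closedBall.inter (isClosed_le continuous_const hrc))
  have hSΩ : ∀ z ∈ S, z ∈ Ω := fun z hz => by
    by_contra hzΩ
    have : z ∈ frontier Ω := by
      rw [hΩo.frontier_eq]
      exact ⟨hz.1, hzΩ⟩
    have h0 : r z = 0 := Metric.infDist_zero_of_mem this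
    have := hz.2.2
    simp only [mem_ofPred_eq] at this
    linarith
  have hxS : x ∈ S :=
    ⟨subset_closure hxΩ, Metric.ball_subset_closedBall hxa, by
      simp only [mem_ofPred_eq]; linarith⟩
  set ψ : ℝ → ℝ := fun s => 2 * K * √a - 2 * K * √(s - δ) with hψ
  have hwc : ContinuousOn (fun z => u z - ψ (r z)) S :=
    (huc.mono inter_subset_left).sub (Continuous.continuousOn (by fun_prop))
  obtain ⟨x₀, hx₀S, hx₀max⟩ := hScomp.exists_isMaxOn ⟨x, hxS⟩ hwc
  have hx₀Ω := hSΩ x₀ hx₀S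
  have hx₀a : dist x₀ y ≤ a := hx₀S.2.1
  have hx₀δ : δ ≤ r x₀ := hx₀S.2.2
  have hψnn : 0 ≤ ψ (r x₀) := by
    have : √(r x₀ - δ) ≤ √a := Real.sqrt_le_sqrt (by linarith [hrle x₀])
    simp only [hψ]
    nlinarith
  have hΩnhds : Ω ∈ 𝓝 x₀ := hΩo.mem_nhds hx₀Ω
  have hx₀ball : x₀ ∈ Metric.ball y a₁ := by
    rw [Metric.mem_ball]; linarith
  have hu₀ : ContDiffAt ℝ 2 u x₀ := hu.contDiffAt hΩnhds
  have hr₀ : ContDiffAt ℝ 2 r x₀ :=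
    hr_reg.contDiffAt (inter_mem (mem_of_superset hΩnhds subset_closure)
      (Metric.isOpen_ball.mem_nhds hx₀ball))
  obtain ⟨e, hen, hre, hree⟩ := exists_unit_infDist_derivs hFc hFne (hF x₀ hx₀Ω) hr₀
  suffices hsuff : dist x₀ y = a by
    have h1 : u x₀ ≤ M := le_csSup hbdd ⟨x₀, ⟨hx₀Ω, hsuff⟩, rfl⟩
    have h2 : u x - ψ (r x) ≤ u x₀ - ψ (r x₀) := hx₀max hxS
    have h3 : ψ (r x) ≤ 2 * K * √a := by
      have : 0 ≤ 2 * K * √(r x - δ) := by positivity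
      simp only [hψ]
      linarith
    linarith
  by_contra hne
  have hlt : dist x₀ y < a := lt_of_le_of_ne hx₀a hne
  have hnear : ∀ᶠ z in 𝓝 x₀, z ∈ Ω ∧ dist z y < a :=
    Filter.Eventually.and (hΩo.mem_nhds hx₀Ω) (Metric.isOpen_ball.mem_nhds hlt)
  rcases hx₀δ.eq_or_lt with hEq | hLt
  · have hcl : Tendsto (fun t : ℝ => x₀ + t • e) (𝓝[>] 0) (𝓝 x₀) := by
      have : Continuous fun t : ℝ => x₀ + t • e := by fun_prop
      simpa using (this.tendsto 0).mono_left nhdsWithin_le_nhds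
    have hdu : HasDerivAt (fun t : ℝ => u (x₀ + t • e)) (fderiv ℝ u x₀ e) 0 := by
      simpa using hasDerivAt_comp_line (eventually_differentiableAt_line hu₀ e).self_of_nhds
    have hdr : HasDerivAt (fun t : ℝ => r (x₀ + t • e)) 1 0 := by
      have := hasDerivAt_comp_line (eventually_differentiableAt_line hr₀ e).self_of_nhds
      rwa [zero_smul, add_zero, hre, real_inner_self_eq_norm_sq, hen, one_pow] at this
    obtain ⟨t, ⟨ht1, ht2⟩, ht3, ht4⟩ :=
      ((eventually_lt_add_sqrt (K := 2 * K) (by positivity) hdu hdr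
        (by simpa using hEq.symm)).and (hcl.eventually hnear)).exists
    have h1 : u (x₀ + t • e) - ψ (r (x₀ + t • e)) ≤ u x₀ - ψ (r x₀) :=
      hx₀max ⟨subset_closure ht3, ht4.le, ht1⟩
    simp only [hψ, ← hEq, sub_self, Real.sqrt_zero, zero_smul, add_zero] at h1 ht2
    linarith
  · have hmax : IsLocalMax (fun z => u z - ψ (r z)) x₀ := by
      filter_upwards [hnear, (isOpen_lt continuous_const hrc).mem_nhds hLt] with z hz1 hz2
      exact hx₀max ⟨subset_closure hz1.1, hz1.2.le, le_of_lt hz2⟩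
    set σ := √(r x₀ - δ) with hσ
    have hσpos : 0 < σ := Real.sqrt_pos.2 (by linarith)
    have hσa : σ ≤ √a := Real.sqrt_le_sqrt (by linarith [hrle x₀])
    have h1 := meanCurvature_le_of_isLocalMax (b := K / σ) hu₀ hr₀
      ((lt_mem_nhds hLt).mono fun s hs => hasDerivAt_sqrt_profile (2 * K * √a) K hs)
      (hasDerivAt_deriv_sqrt_profile K hLt) hmax (by positivity) rfl hen hre hree
    rw [hse x₀ hx₀Ω] at h1
    have h2 := soliton_rhs_ge (n := n) hm (hum x₀ hx₀Ω)
    have h3 : K / σ * (2 * θ) ≤ K / σ * lap n r x₀ :=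
      mul_le_mul_of_nonneg_left (hr_lap x₀ ⟨hx₀Ω, hx₀ball⟩) (by positivity)
    have h4 : K / (2 * σ ^ 3) / (1 + (K / σ) ^ 2) ≤ κ / (2 * σ) := by
      calc K / (2 * σ ^ 3) / (1 + (K / σ) ^ 2) ≤ K / (2 * σ ^ 3) / (K / σ) ^ 2 := by
            gcongr
            linarith
        _ = κ / (2 * σ) := by
            rw [hK]
            field_simp
    have h5 : K / σ * (2 * θ) = 2 * (κ / σ) := by
      rw [hK, ← hκ2]
      field_simp
    have h6 : C < κ / σ := by
      rw [lt_div_iff₀ hσpos]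
      nlinarith
    have h7 : κ / (2 * σ) = (κ / σ) / 2 := by field_simp
    linarith
end

section
/- Let n ≥ 2, let Ω ⊂ ℝⁿ be a bounded open set with C² boundary, let y ∈ ∂Ω, and suppose there exist a₁ > 0 and θ > 0 such that the distance function r(x) = dist(x, ∂Ω) is C² on Ω̄ ∩ B_{a₁}(y) with Δr ≥ 2θ on Ω ∩ B_{a₁}(y) (this holds when the inward mean curvature of ∂Ω at y is strictly negative). Then there exists a continuous function φ : ∂Ω → (0,∞) such that no function u ∈ C^∞(Ω) ∩ C(Ω̄), positive on Ω, solves the soliton equation (SE) on Ω with u = φ on ∂Ω. -/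
open Set Filter Topology

theorem IsLocalMin.deriv_deriv_nonneg {f : ℝ → ℝ} {x : ℝ} (h : IsLocalMin f x)
    (hc : ContinuousAt f x) : 0 ≤ deriv (deriv f) x := by
  by_contra! hneg
  have hmax := isLocalMax_of_deriv_deriv_neg hneg h.deriv_eq_zero hc
  have hconst : f =ᶠ[𝓝 x] fun _ => f x := by
    filter_upwards [h, hmax] with z hz₁ hz₂ using le_antisymm hz₂ hz₁
  have hderiv : deriv f =ᶠ[𝓝 x] fun _ => 0 := by
    filter_upwards [hconst.eventuallyEq_nhds] with z hz
    rw [hz.deriv_eq, deriv_const]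
  rw [hderiv.deriv_eq, deriv_const] at hneg
  exact lt_irrefl _ hneg

section PartialDerivatives

variable {n : ℕ} {f u g : EuclideanSpace ℝ (Fin n) → ℝ} {x : EuclideanSpace ℝ (Fin n)}

theorem fderiv_toLp_eq_sum_pd (v : Fin n → ℝ) :
    fderiv ℝ f x (WithLp.toLp 2 v) = ∑ i, v i * pd n f i x := by
  have hv : WithLp.toLp 2 v = ∑ i, v i • EuclideanSpace.single i (1 : ℝ) := by
    ext j
    simp [Finset.sum_apply, Pi.single_apply]
  rw [hv, map_sum]
  simp [pd]

theorem ContDiffAt.differentiableAt_pd_s6 (hf : ContDiffAt ℝ 2 f x) (i : Fin n) :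
    DifferentiableAt ℝ (pd n f i) x :=
  ((hf.fderiv_right (m := 1) (by norm_num)).clm_apply contDiffAt_const).differentiableAt
    (by norm_num)

theorem ContDiffAt.eventually_differentiableAt (hf : ContDiffAt ℝ 2 f x) :
    ∀ᶠ z in 𝓝 x, DifferentiableAt ℝ f z := by
  filter_upwards [hf.eventually (by simp)] with z hz using hz.differentiableAt (by norm_num)

theorem pd2_eq_fderiv_pd (i j : Fin n) :
    pd2 n f i j x = fderiv ℝ (pd n f j) x (EuclideanSpace.single i 1) := rfl

theorem IsLocalMin.pd_eq_zero (h : IsLocalMin f x) (i : Fin n) : pd n f i x = 0 := by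
  simp [pd, h.fderiv_eq_zero]

/-- Second-order necessary condition at an interior minimum. -/
theorem IsLocalMin.hessian_nonneg (h : IsLocalMin f x) (hf : ContDiffAt ℝ 2 f x)
    (v : Fin n → ℝ) : 0 ≤ ∑ i, ∑ j, v i * v j * pd2 n f i j x := by
  set e : EuclideanSpace ℝ (Fin n) := WithLp.toLp 2 v
  set γ : ℝ → EuclideanSpace ℝ (Fin n) := fun t => x + t • e
  have hγ (t : ℝ) : HasDerivAt γ e t := by
    simpa [γ] using ((hasDerivAt_id t).smul_const e).const_add x
  have hγ0 : γ 0 = x := by simp [γ]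
  have hγc : Tendsto γ (𝓝 0) (𝓝 x) := by simpa [hγ0] using (hγ 0).continuousAt.tendsto
  have hmin : IsLocalMin (f ∘ γ) 0 := by
    have := hγc.eventually h
    simpa [IsLocalMin, IsMinFilter, hγ0] using this
  have hd : deriv (f ∘ γ) =ᶠ[𝓝 0] fun t => ∑ j, v j * pd n f j (γ t) := by
    filter_upwards [hγc.eventually hf.eventually_differentiableAt] with t ht
    rw [(ht.hasFDerivAt.comp_hasDerivAt t (hγ t)).deriv, fderiv_toLp_eq_sum_pd]
  have hdd : HasDerivAt (fun t => ∑ j, v j * pd n f j (γ t))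
      (∑ j, v j * fderiv ℝ (pd n f j) x e) 0 := by
    refine HasDerivAt.fun_sum fun j _ => HasDerivAt.const_mul _ ?_
    have hj : HasFDerivAt (pd n f j) (fderiv ℝ (pd n f j) x) (γ 0) := by
      rw [hγ0]; exact (hf.differentiableAt_pd_s6 j).hasFDerivAt
    exact hj.comp_hasDerivAt 0 (hγ 0)
  have hcont : ContinuousAt (f ∘ γ) 0 :=
    ContinuousAt.comp (by rw [hγ0]; exact hf.continuousAt) (hγ 0).continuousAt
  have key := hmin.deriv_deriv_nonneg hcont
  rw [hd.deriv_eq, hdd.deriv] at key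
  refine key.trans_eq ?_
  rw [Finset.sum_comm]
  refine Finset.sum_congr rfl fun j _ => ?_
  rw [fderiv_toLp_eq_sum_pd, Finset.mul_sum]
  refine Finset.sum_congr rfl fun i _ => ?_
  rw [pd2_eq_fderiv_pd, ← mul_assoc, mul_comm (v j)]
  rfl

/-- Trace of a nonnegative form against the coefficients of the minimal surface operator. -/
theorem trace_sub_nonneg_of_form_nonneg (B : Fin n → Fin n → ℝ)
    (hB : ∀ v : Fin n → ℝ, 0 ≤ ∑ i, ∑ j, v i * v j * B i j) (p : Fin n → ℝ) :
    (∑ i, ∑ j, B i j * p i * p j) ≤ (1 + ∑ i, p i ^ 2) * ∑ i, B i i := by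
  set s := ∑ i, p i ^ 2 with hs
  have hs0 : 0 ≤ s := Finset.sum_nonneg fun i _ => sq_nonneg _
  set q := ∑ i, ∑ j, B i j * p i * p j with hq
  have hq0 : 0 ≤ q := by
    refine (hB p).trans_eq (Finset.sum_congr rfl fun i _ => Finset.sum_congr rfl fun j _ => ?_)
    ring
  have hk (k : Fin n) : 0 ≤ (1 + s) ^ 2 * B k k - (1 + s) * p k * (∑ j, B k j * p j)
      - (1 + s) * p k * (∑ i, B i k * p i) + p k ^ 2 * q := by
    refine (hB fun i => (if i = k then 1 + s else 0) - p k * p i).trans_eq ?_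
    have (i j : Fin n) : ((if i = k then 1 + s else 0) - p k * p i) *
        ((if j = k then 1 + s else 0) - p k * p j) * B i j =
        (if i = k then (if j = k then (1 + s) ^ 2 * B i j else 0) else 0)
        - (if i = k then (1 + s) * p k * (B i j * p j) else 0)
        - (if j = k then (1 + s) * p k * (B i j * p i) else 0)
        + p k ^ 2 * (B i j * p i * p j) := by
      split_ifs <;> ring
    simp only [this, Finset.sum_add_distrib, Finset.sum_sub_distrib, hq, Finset.mul_sum]
    congr 1
    congr 1
    · congr 1
      · simp
      · rw [Finset.sum_comm]; simp
    · simp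
  have hsum := Finset.sum_nonneg fun k (_ : k ∈ Finset.univ) => hk k
  have h1 : ∑ k, (1 + s) * p k * (∑ j, B k j * p j) = (1 + s) * q := by
    simp only [hq, Finset.mul_sum]
    exact Finset.sum_congr rfl fun i _ => Finset.sum_congr rfl fun j _ => by ring
  have h2 : ∑ k, (1 + s) * p k * (∑ i, B i k * p i) = (1 + s) * q := by
    simp only [hq, Finset.mul_sum]
    rw [Finset.sum_comm]
    exact Finset.sum_congr rfl fun i _ => Finset.sum_congr rfl fun j _ => by ring
  rw [Finset.sum_add_distrib, Finset.sum_sub_distrib, Finset.sum_sub_distrib, h1, h2,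
    ← Finset.mul_sum, ← Finset.sum_mul, ← hs] at hsum
  have : 0 ≤ (1 + s) * ((1 + s) * ∑ i, B i i - q) := by nlinarith
  linarith [nonneg_of_mul_nonneg_right this (by linarith)]

/-- If `(u - c)² - κ g` has a zero minimum at a point where `u` is a strict supersolution of the
minimal surface equation, then `c + √(κ g)` is not a subsolution there. -/
theorem no_touching {c κ : ℝ} (hu : ContDiffAt ℝ 2 u x) (hg : ContDiffAt ℝ 2 g x)
    (hκ : 0 < κ) (hc : c ≤ u x) (h0 : (u x - c) ^ 2 = κ * g x)
    (hmin : IsLocalMin (fun z => (u z - c) ^ 2 - κ * g z) x)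
    (hQ : lap n u x - hessQuad n u x / (1 + gradNormSq n u x) < 0)
    (hG : 0 < gradNormSq n g x) :
    (4 * g x + κ * gradNormSq n g x) * lap n g x - κ * hessQuad n g x
      < 2 * gradNormSq n g x := by
  set f : EuclideanSpace ℝ (Fin n) → ℝ := fun z => (u z - c) ^ 2 - κ * g z with hf
  have hfc : ContDiffAt ℝ 2 f x := ((hu.sub contDiffAt_const).pow 2).sub (contDiffAt_const.mul hg)
  have hpd (i : Fin n) :
      pd n f i =ᶠ[𝓝 x] fun z => 2 * (u z - c) * pd n u i z - κ * pd n g i z := by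
    filter_upwards [hu.eventually_differentiableAt, hg.eventually_differentiableAt] with z hz hz'
    have := (((hz.hasFDerivAt.sub_const c).pow 2).sub (hz'.hasFDerivAt.const_mul κ)).fderiv
    simp only [pd]
    rw [show fderiv ℝ f z = _ from this]
    simp
  have hpd2 (i j : Fin n) : pd2 n f i j x =
      2 * (pd n u i x * pd n u j x) + 2 * (u x - c) * pd2 n u i j x - κ * pd2 n g i j x := by
    rw [pd2_eq_fderiv_pd, (hpd j).fderiv_eq]
    have := (((((hu.differentiableAt (by norm_num)).hasFDerivAt.sub_const c).const_mul 2).mul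
      (hu.differentiableAt_pd_s6 j).hasFDerivAt).sub
        ((hg.differentiableAt_pd_s6 j).hasFDerivAt.const_mul κ)).fderiv
    rw [show fderiv ℝ (fun z => 2 * (u z - c) * pd n u j z - κ * pd n g j z) x = _ from this]
    simp [pd2_eq_fderiv_pd]
    simp [pd]
    ring
  have hgrad (i : Fin n) : κ * pd n g i x = 2 * (u x - c) * pd n u i x := by
    have := (hpd i).eq_of_nhds
    rw [hmin.pd_eq_zero] at this
    linarith
  set v := u x - c with hv
  set s := gradNormSq n u x with hs
  have hgs : κ ^ 2 * gradNormSq n g x = 4 * v ^ 2 * s := by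
    simp only [hs, gradNormSq, Finset.mul_sum]
    refine Finset.sum_congr rfl fun i _ => ?_
    rw [← mul_pow, hgrad]; ring
  have hgh : κ ^ 2 * hessQuad n g x =
      4 * v ^ 2 * ∑ i, ∑ j, pd2 n g i j x * pd n u i x * pd n u j x := by
    simp only [hessQuad, Finset.mul_sum]
    refine Finset.sum_congr rfl fun i _ => Finset.sum_congr rfl fun j _ => ?_
    linear_combination pd2 n g i j x * (κ * pd n g j x * hgrad i
      + 2 * v * pd n u i x * hgrad j)
  have hvpos : 0 < v := by
    refine lt_of_le_of_ne (by linarith) fun h => ?_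
    rw [← h] at hgs
    have : 0 < κ ^ 2 * gradNormSq n g x := by positivity
    simp [hgs] at this
  have hs0 : 0 ≤ s := Finset.sum_nonneg fun i _ => sq_nonneg _
  have htr := trace_sub_nonneg_of_form_nonneg (fun i j => pd2 n f i j x)
    (hmin.hessian_nonneg hfc) (fun i => pd n u i x)
  set q := ∑ i, ∑ j, pd2 n g i j x * pd n u i x * pd n u j x with hq
  have hL : ∑ i, ∑ j, pd2 n f i j x * pd n u i x * pd n u j x =
      2 * s ^ 2 + 2 * v * hessQuad n u x - κ * q := by
    have (i j : Fin n) : pd2 n f i j x * pd n u i x * pd n u j x =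
        2 * (pd n u i x ^ 2 * pd n u j x ^ 2) + 2 * v * (pd2 n u i j x * pd n u i x * pd n u j x)
        - κ * (pd2 n g i j x * pd n u i x * pd n u j x) := by
      rw [hpd2]; ring
    simp only [this, Finset.sum_add_distrib, Finset.sum_sub_distrib, ← Finset.mul_sum]
    rw [← Finset.sum_mul, hq, sq s, hs]
    simp only [gradNormSq, hessQuad]
  have hR : ∑ i, pd2 n f i i x = 2 * s + 2 * v * lap n u x - κ * lap n g x := by
    simp only [hpd2, Finset.sum_add_distrib, Finset.sum_sub_distrib, ← Finset.mul_sum, hs,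
      gradNormSq, lap, sq]
  change _ ≤ (1 + s) * _ at htr
  rw [hL, hR] at htr
  have hQ' : (1 + s) * lap n u x < hessQuad n u x := by
    rw [sub_neg, lt_div_iff₀ (by linarith)] at hQ
    linarith
  have h1 : κ * ((1 + s) * lap n g x - q) < 2 * s := by
    nlinarith [mul_lt_mul_of_pos_left hQ' hvpos]
  have h2 : κ ^ 2 * ((4 * g x + κ * gradNormSq n g x) * lap n g x - κ * hessQuad n g x)
      = κ * (4 * v ^ 2) * ((1 + s) * lap n g x - q) := by
    linear_combination (κ * lap n g x) * hgs - κ * hgh - 4 * κ * lap n g x * h0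
  have h3 : κ ^ 2 * ((4 * g x + κ * gradNormSq n g x) * lap n g x - κ * hessQuad n g x)
      < κ ^ 2 * (2 * gradNormSq n g x) := by
    have := mul_lt_mul_of_pos_left h1 (show 0 < 4 * v ^ 2 by positivity)
    rw [h2]
    linear_combination this - 2 * hgs
  exact lt_of_mul_lt_mul_left h3 (by positivity)

/-- Comparison with the lower barrier `b + √(κ g)`, which may have infinite slope on `{g = 0}`. -/
theorem barrier_le {K : Set (EuclideanSpace ℝ (Fin n))} {b κ : ℝ} (hK : IsCompact K)
    (hu : ContinuousOn u K) (hg : ContinuousOn g K) (hκ : 0 < κ)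
    (h : ∀ x ∈ K, b + √(κ * g x) ≤ u x ∨
      ((∀ᶠ z in 𝓝 x, 0 ≤ g z → z ∈ K) ∧ 0 ≤ g x ∧ ContDiffAt ℝ 2 u x ∧ ContDiffAt ℝ 2 g x ∧
        lap n u x - hessQuad n u x / (1 + gradNormSq n u x) < 0 ∧ 0 < gradNormSq n g x ∧
        2 * gradNormSq n g x ≤
          (4 * g x + κ * gradNormSq n g x) * lap n g x - κ * hessQuad n g x)) :
    ∀ x ∈ K, b + √(κ * g x) ≤ u x := by
  intro y hy
  obtain ⟨x, hxK, hx⟩ := hK.exists_isMinOn ⟨y, hy⟩ (hu.sub (hg.const_smul κ).sqrt)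
  replace hx : ∀ z ∈ K, u x - √(κ * g x) ≤ u z - √(κ * g z) := hx
  rcases h x hxK with hb | ⟨hev, hg0, huc, hgc, hQ, hG, hle⟩
  · linarith [hx y hy]
  exfalso
  set c := u x - √(κ * g x) with hc
  have h0 : (u x - c) ^ 2 - κ * g x = 0 := by
    rw [hc, sub_sub_cancel, Real.sq_sqrt (by positivity), sub_self]
  refine (no_touching (c := c) huc hgc hκ ?_ (sub_eq_zero.1 h0) ?_ hQ hG).not_ge hle
  · linarith [Real.sqrt_nonneg (κ * g x)]
  · filter_upwards [hev] with z hz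
    rw [h0, sub_nonneg]
    rcases lt_or_ge (g z) 0 with hneg | hpos
    · nlinarith [sq_nonneg (u z - c)]
    · exact Real.sqrt_le_iff.1 (by linarith [hx z (hz hpos)]) |>.2

theorem pd_sub_const (a : ℝ) : pd n (fun z => f z - a) = pd n f := by
  ext i z
  rw [pd, pd, fderiv_sub_const]

theorem pd2_sub_const (a : ℝ) : pd2 n (fun z => f z - a) = pd2 n f := by
  ext i j z
  rw [pd2_eq_fderiv_pd, pd2_eq_fderiv_pd, pd_sub_const]

theorem gradNormSq_sub_const (a : ℝ) : gradNormSq n (fun z => f z - a) = gradNormSq n f := by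
  ext z
  simp only [gradNormSq, pd_sub_const]

theorem lap_sub_const (a : ℝ) : lap n (fun z => f z - a) = lap n f := by
  ext z
  simp only [lap, pd2_sub_const]

theorem hessQuad_sub_const (a : ℝ) : hessQuad n (fun z => f z - a) = hessQuad n f := by
  ext z
  simp only [hessQuad, pd_sub_const, pd2_sub_const]

theorem dist_sq_eq_sum_sub_sq (x y : EuclideanSpace ℝ (Fin n)) :
    dist x y ^ 2 = ∑ i, (x i - y i) ^ 2 := by
  simp only [EuclideanSpace.dist_sq_eq, Real.dist_eq, sq_abs]

theorem hasFDerivAt_dist_sq (x y : EuclideanSpace ℝ (Fin n)) :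
    HasFDerivAt (fun z => dist z y ^ 2) (2 • innerSL ℝ (x - y)) x := by
  simp only [dist_eq_norm]
  exact ((hasFDerivAt_id x).sub_const y).norm_sq

theorem pd_dist_sq (y : EuclideanSpace ℝ (Fin n)) (i : Fin n) :
    pd n (fun z => dist z y ^ 2) i = fun z => 2 * (z i - y i) := by
  ext z
  rw [pd, (hasFDerivAt_dist_sq z y).fderiv]
  simp [EuclideanSpace.inner_single_right]

theorem gradNormSq_dist_sq (y : EuclideanSpace ℝ (Fin n)) :
    gradNormSq n (fun z => dist z y ^ 2) x = 4 * dist x y ^ 2 := by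
  simp only [gradNormSq, pd_dist_sq]
  rw [dist_sq_eq_sum_sub_sq, Finset.mul_sum]
  exact Finset.sum_congr rfl fun i _ => by ring

theorem pd2_dist_sq (y : EuclideanSpace ℝ (Fin n)) (i j : Fin n) :
    pd2 n (fun z => dist z y ^ 2) i j x = if j = i then 2 else 0 := by
  rw [pd2_eq_fderiv_pd, pd_dist_sq]
  have := (((EuclideanSpace.proj (𝕜 := ℝ) j).hasFDerivAt (x := x)).sub_const (y j)).const_mul 2
  rw [show fderiv ℝ (fun z : EuclideanSpace ℝ (Fin n) => 2 * (z j - y j)) x = _ from this.fderiv]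
  simp

theorem lap_dist_sq (y : EuclideanSpace ℝ (Fin n)) :
    lap n (fun z => dist z y ^ 2) x = 2 * n := by
  simp [lap, pd2_dist_sq, mul_comm]

theorem hessQuad_dist_sq (y : EuclideanSpace ℝ (Fin n)) :
    hessQuad n (fun z => dist z y ^ 2) x = 8 * dist x y ^ 2 := by
  simp only [hessQuad, pd2_dist_sq, pd_dist_sq, ite_mul, zero_mul, Finset.sum_ite_eq',
    Finset.mem_univ, if_true]
  rw [dist_sq_eq_sum_sub_sq, Finset.mul_sum]
  exact Finset.sum_congr rfl fun i _ => by ring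

/-- The eikonal equation for a distance function at points of differentiability. -/
theorem gradNormSq_infDist {s : Set (EuclideanSpace ℝ (Fin n))} (hs : IsClosed s)
    (hne : s.Nonempty) (hx : x ∉ s)
    (hd : DifferentiableAt ℝ (fun z => Metric.infDist z s) x) :
    gradNormSq n (fun z => Metric.infDist z s) x = 1 := by
  obtain ⟨p, hp, hxp⟩ := hs.exists_infDist_eq_dist hne x
  have hpos : 0 < dist x p := dist_pos.2 fun h => hx (h ▸ hp)
  have hmin : IsLocalMin (fun z => dist z p ^ 2 - Metric.infDist z s ^ 2) x := by
    refine Eventually.of_forall fun z => ?_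
    simp only [hxp, sub_self, sub_nonneg]
    exact pow_le_pow_left₀ Metric.infDist_nonneg (Metric.infDist_le_dist_of_mem hp) 2
  have hpd (i : Fin n) :
      dist x p * pd n (fun z => Metric.infDist z s) i x = x i - p i := by
    have h0 := DFunLike.congr_fun (hmin.hasFDerivAt_eq_zero
      ((hasFDerivAt_dist_sq x p).sub (hd.hasFDerivAt.pow 2))) (EuclideanSpace.single i 1)
    simp [hxp, EuclideanSpace.inner_single_right] at h0
    simp only [pd]
    linarith
  have : dist x p ^ 2 * gradNormSq n (fun z => Metric.infDist z s) x = dist x p ^ 2 * 1 := by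
    rw [mul_one, gradNormSq, Finset.mul_sum]
    refine Eq.trans (Finset.sum_congr rfl fun i _ => ?_) (dist_sq_eq_sum_sub_sq x p).symm
    rw [← mul_pow, hpd]
  exact mul_left_cancel₀ (by positivity) this

theorem hessQuad_eq_zero_of_gradNormSq_const {c : ℝ} (hf : ContDiffAt ℝ 2 f x)
    (h : gradNormSq n f =ᶠ[𝓝 x] fun _ => c) : hessQuad n f x = 0 := by
  have hi (i : Fin n) : ∑ j, pd2 n f i j x * pd n f j x = 0 := by
    have hd := (HasFDerivAt.fun_sum (u := Finset.univ) fun j _ =>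
      (hf.differentiableAt_pd_s6 j).hasFDerivAt.pow 2).fderiv
    have h0 : fderiv ℝ (gradNormSq n f) x = 0 := by rw [h.fderiv_eq]; simp
    rw [show fderiv ℝ (gradNormSq n f) x = _ from hd] at h0
    have := DFunLike.congr_fun h0 (EuclideanSpace.single i 1)
    simp [mul_assoc, ← Finset.mul_sum, ← pd2_eq_fderiv_pd] at this
    rw [← this]
    exact Finset.sum_congr rfl fun j _ => mul_comm _ _
  simp only [hessQuad]
  refine Finset.sum_eq_zero fun i _ => ?_
  rw [← mul_zero (pd n f i x), ← hi i, Finset.mul_sum]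
  exact Finset.sum_congr rfl fun j _ => by ring

theorem SolvesSE.operator_neg {Ω : Set (EuclideanSpace ℝ (Fin n))} (h : SolvesSE n Ω u) (hx : x ∈ Ω)
    (hux : 0 < u x) : lap n u x - hessQuad n u x / (1 + gradNormSq n u x) < 0 := by
  rw [h x hx, neg_div, neg_lt_zero]
  positivity

/-- Lower bound away from `y` from the hyperboloid barrier `b + √(|x - y|² - a²)`. -/
theorem lower_bound_outside_ball (hn : 2 ≤ n) {Ω : Set (EuclideanSpace ℝ (Fin n))}
    (hΩo : IsOpen Ω) (y : EuclideanSpace ℝ (Fin n)) {a D m : ℝ} (ha : 0 < a)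
    (hD : closure Ω ⊆ Metric.closedBall y D) (hΩb : Bornology.IsBounded Ω)
    (hu : ContDiffOn ℝ 2 u Ω) (huc : ContinuousOn u (closure Ω))
    (hQ : ∀ x ∈ Ω, lap n u x - hessQuad n u x / (1 + gradNormSq n u x) < 0)
    (hm : ∀ x ∈ frontier Ω, a ≤ dist x y → m + D ≤ u x) :
    ∀ x ∈ Ω, a ≤ dist x y → m ≤ u x := by
  set g : EuclideanSpace ℝ (Fin n) → ℝ := fun z => dist z y ^ 2 - a ^ 2 with hg
  have hgd : ContDiff ℝ 2 g := by
    simp only [hg, dist_eq_norm]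
    exact ((contDiff_id.sub contDiff_const).norm_sq ℝ).sub contDiff_const
  have hK : IsCompact (closure Ω ∩ {z | 0 ≤ g z}) :=
    hΩb.isCompact_closure.inter_right (isClosed_le continuous_const hgd.continuous)
  have hbar := barrier_le (b := m) (κ := 1) hK (huc.mono inter_subset_left)
    hgd.continuous.continuousOn one_pos ?_
  · intro x hx hax
    have := hbar x ⟨subset_closure hx, sub_nonneg.2 (pow_le_pow_left₀ ha.le hax 2)⟩
    linarith [Real.sqrt_nonneg (1 * g x)]
  rintro x ⟨hxc, hgx⟩
  have hgx' : a ^ 2 ≤ dist x y ^ 2 := sub_nonneg.1 hgx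
  by_cases hx : x ∈ Ω
  · refine Or.inr ⟨?_, hgx, hu.contDiffAt (hΩo.mem_nhds hx), hgd.contDiffAt, hQ x hx, ?_, ?_⟩
    · filter_upwards [hΩo.mem_nhds hx] with z hz hgz using ⟨subset_closure hz, hgz⟩
    · rw [hg, gradNormSq_sub_const, gradNormSq_dist_sq]
      linarith [pow_pos ha 2]
    · rw [hg, gradNormSq_sub_const, gradNormSq_dist_sq, lap_sub_const, lap_dist_sq,
        hessQuad_sub_const, hessQuad_dist_sq]
      have hn' : (2 : ℝ) ≤ n := by exact_mod_cast hn
      nlinarith [mul_le_mul_of_nonneg_right hn'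
        (show 0 ≤ (dist x y ^ 2 - a ^ 2) + dist x y ^ 2 by positivity)]
  · left
    have hxf : x ∈ frontier Ω := ⟨hxc, by rwa [hΩo.interior_eq]⟩
    have h1 := hm x hxf (abs_le_of_sq_le_sq' hgx' dist_nonneg).2
    have h2 : √(1 * g x) ≤ D := by
      refine le_trans (Real.sqrt_le_iff.2 ⟨dist_nonneg, ?_⟩) (hD hxc)
      rw [one_mul]
      exact sub_le_self _ (sq_nonneg a)
    linarith

/-- Lower bound up to a boundary point where `Δ dist(·, ∂Ω)` is bounded below by `2θ > 0`, from
the barriers `b + √((dist(·, ∂Ω) - ε) / θ)`. -/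
theorem lower_bound_near_boundary {Ω : Set (EuclideanSpace ℝ (Fin n))}
    (hΩo : IsOpen Ω) (hΩb : Bornology.IsBounded Ω) {y : EuclideanSpace ℝ (Fin n)}
    (hy : y ∈ frontier Ω) {a a₁ θ m : ℝ} (ha : a < a₁) (hθ : 0 < θ)
    (hr_reg : ContDiffOn ℝ 2 (fun x => Metric.infDist x (frontier Ω))
      (closure Ω ∩ Metric.ball y a₁))
    (hr_lap : ∀ x ∈ Ω ∩ Metric.ball y a₁,
      2 * θ ≤ lap n (fun z => Metric.infDist z (frontier Ω)) x)
    (hu : ContDiffOn ℝ 2 u Ω) (huc : ContinuousOn u (closure Ω))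
    (hQ : ∀ x ∈ Ω, lap n u x - hessQuad n u x / (1 + gradNormSq n u x) < 0)
    (hm : ∀ x ∈ Ω, dist x y = a → m + √(θ⁻¹ * a) ≤ u x) :
    ∀ x ∈ Ω, dist x y ≤ a → m ≤ u x := by
  set r : EuclideanSpace ℝ (Fin n) → ℝ := fun z => Metric.infDist z (frontier Ω) with hr
  have hrc : Continuous r := Metric.continuous_infDist_pt _
  have hopen : IsOpen (Ω ∩ Metric.ball y a₁) := hΩo.inter Metric.isOpen_ball
  have hnot (z) (hz : z ∈ Ω) : z ∉ frontier Ω := fun h => h.2 (by rwa [hΩo.interior_eq])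
  have hrd (z) (hz : z ∈ Ω ∩ Metric.ball y a₁) : ContDiffAt ℝ 2 r z :=
    hr_reg.contDiffAt (mem_of_superset (hopen.mem_nhds hz)
      (inter_subset_inter_left _ subset_closure))
  have hrG (z) (hz : z ∈ Ω ∩ Metric.ball y a₁) : gradNormSq n r z = 1 :=
    gradNormSq_infDist isClosed_frontier ⟨y, hy⟩ (hnot z hz.1)
      ((hrd z hz).differentiableAt (by norm_num))
  have hrH (z) (hz : z ∈ Ω ∩ Metric.ball y a₁) : hessQuad n r z = 0 :=
    hessQuad_eq_zero_of_gradNormSq_const (hrd z hz)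
      (mem_of_superset (hopen.mem_nhds hz) hrG)
  intro x₀ hx₀ hxa
  set ε := r x₀ with hε
  have hεpos : 0 < ε :=
    (isClosed_frontier.notMem_iff_infDist_pos ⟨y, hy⟩).1 (hnot x₀ hx₀)
  have hK : IsCompact (closure Ω ∩ (Metric.closedBall y a ∩ {z | 0 ≤ r z - ε})) :=
    hΩb.isCompact_closure.inter_right (Metric.isClosed_closedBall.inter
      (isClosed_le continuous_const (hrc.sub continuous_const)))
  have hbar := barrier_le (b := m) (κ := θ⁻¹) (g := fun z => r z - ε) hK
    (huc.mono inter_subset_left) (hrc.sub continuous_const).continuousOn (inv_pos.2 hθ) ?_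
  · have := hbar x₀ ⟨subset_closure hx₀, hxa, by simp [hε]⟩
    linarith [Real.sqrt_nonneg (θ⁻¹ * (r x₀ - ε))]
  rintro x ⟨hxc, hxa, hrx⟩
  have hrx' : 0 ≤ r x - ε := hrx
  have hxΩ : x ∈ Ω := by
    by_contra hx
    have : r x = 0 := Metric.infDist_zero_of_mem ⟨hxc, by rwa [hΩo.interior_eq]⟩
    linarith
  rcases (show dist x y ≤ a from hxa).eq_or_lt with heq | hlt
  · left
    refine le_trans ?_ (hm x hxΩ heq)
    have : r x ≤ a := heq ▸ Metric.infDist_le_dist_of_mem hy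
    have : √(θ⁻¹ * (r x - ε)) ≤ √(θ⁻¹ * a) :=
      Real.sqrt_le_sqrt (mul_le_mul_of_nonneg_left (by linarith) (inv_pos.2 hθ).le)
    linarith
  · have hxb : x ∈ Ω ∩ Metric.ball y a₁ := ⟨hxΩ, hlt.trans ha⟩
    refine Or.inr ⟨?_, hrx', hu.contDiffAt (hΩo.mem_nhds hxΩ), (hrd x hxb).sub contDiffAt_const,
      hQ x hxΩ, ?_, ?_⟩
    · filter_upwards [hΩo.mem_nhds hxΩ, Metric.isOpen_ball.mem_nhds hlt] with z hz hza hgz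
        using ⟨subset_closure hz, Metric.ball_subset_closedBall hza, hgz⟩
    · rw [gradNormSq_sub_const, hrG x hxb]
      exact one_pos
    · rw [gradNormSq_sub_const, lap_sub_const, hessQuad_sub_const, hrG x hxb, hrH x hxb]
      have h1 := mul_le_mul_of_nonneg_left (hr_lap x hxb) (inv_pos.2 hθ).le
      have h2 : θ⁻¹ * (2 * θ) = 2 := by field_simp
      have h3 : 0 ≤ (r x - ε) * lap n r x :=
        mul_nonneg hrx' (le_trans (by positivity) (hr_lap x hxb))
      linarith

end PartialDerivatives

/-- non-solvability of the Dirichlet problem (Theorem B(2)).  If near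
some boundary point `y` the distance function to `∂Ω` is `C²` with
`Δ dist(·,∂Ω) ≥ 2θ > 0` (which holds when the inward mean curvature of the `C²`
boundary at `y` is strictly negative), then there is a continuous positive boundary
datum `φ` for which no positive `u ∈ C^∞(Ω) ∩ C(Ω̄)` solves (SE) with `u = φ` on `∂Ω`. -/
theorem SE_Dirichlet_nonexistence (n : ℕ) (hn : 2 ≤ n)
    (Ω : Set (EuclideanSpace ℝ (Fin n)))
    (hΩo : IsOpen Ω) (hΩb : Bornology.IsBounded Ω)
    (y : EuclideanSpace ℝ (Fin n)) (hy : y ∈ frontier Ω)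
    (a₁ θ : ℝ) (ha₁ : 0 < a₁) (hθ : 0 < θ)
    (hr_reg : ContDiffOn ℝ 2 (fun x => Metric.infDist x (frontier Ω))
      (closure Ω ∩ Metric.ball y a₁))
    (hr_lap : ∀ x ∈ Ω ∩ Metric.ball y a₁,
      2 * θ ≤ lap n (fun z => Metric.infDist z (frontier Ω)) x) :
    ∃ φ : EuclideanSpace ℝ (Fin n) → ℝ,
      ContinuousOn φ (frontier Ω) ∧ (∀ x ∈ frontier Ω, 0 < φ x) ∧
      ¬ ∃ u : EuclideanSpace ℝ (Fin n) → ℝ,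
          ContDiffOn ℝ (⊤ : ℕ∞) u Ω ∧ ContinuousOn u (closure Ω) ∧
          (∀ x ∈ Ω, 0 < u x) ∧ SolvesSE n Ω u ∧
          ∀ x ∈ frontier Ω, u x = φ x := by
  set a := a₁ / 2 with ha_def
  have ha : 0 < a := half_pos ha₁
  obtain ⟨D, hD⟩ := hΩb.closure.subset_closedBall y
  have hD0 : 0 ≤ D := by simpa using hD hy.1
  set L := (1 + √(θ⁻¹ * a) + D) / a with hL
  have hLa : L * a = 1 + √(θ⁻¹ * a) + D := div_mul_cancel₀ _ ha.ne'
  have hL0 : 0 ≤ L := by positivity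
  refine ⟨fun x => 1 + L * dist x y, by fun_prop, fun x _ => by positivity, ?_⟩
  rintro ⟨u, hu, huc, hpos, hSE, hbd⟩
  have hu2 : ContDiffOn ℝ 2 u Ω := hu.of_le (WithTop.coe_le_coe.2 le_top)
  have hQ (x) (hx : x ∈ Ω) := hSE.operator_neg hx (hpos x hx)
  have hout := lower_bound_outside_ball (m := 2 + √(θ⁻¹ * a)) hn hΩo y ha hD hΩb hu2 huc hQ
    fun x hx hax => by
      rw [hbd x hx]
      linarith [mul_le_mul_of_nonneg_left hax hL0]
  have hin := lower_bound_near_boundary hΩo hΩb hy (half_lt_self ha₁) hθ hr_reg hr_lap hu2 huc hQ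
    fun x hx hxa => hout x hx hxa.ge
  have hΩ (x) (hx : x ∈ Ω) : 2 ≤ u x := by
    rcases le_total (dist x y) a with h | h
    · exact hin x hx h
    · linarith [hout x hx h, Real.sqrt_nonneg (θ⁻¹ * a)]
  have huy : 2 ≤ u y := by
    have : (𝓝[Ω] y).NeBot := mem_closure_iff_nhdsWithin_neBot.1 hy.1
    exact ge_of_tendsto ((huc y hy.1).mono_left (nhdsWithin_mono y subset_closure))
      (eventually_mem_nhdsWithin.mono hΩ)
  have huy' : u y = 1 := by simp [hbd y hy]
  linarith
end

section
/- Let n ≥ 2, R > 0 and x₀ ∈ ℝⁿ, and define u(x) = √(R² − |x−x₀|²) on the open Euclidean ball B_R(x₀). Then u is a subsolution of the soliton equation: Δu − (D²u)(Du,Du)/(1+|Du|²) ≥ −(1+nu)/u² on B_R(x₀); equivalently, div(Du/√(1+|Du|²)) ≥ −(1+nu)/(u²√(1+|Du|²)). (Geometrically: Euclidean half-spheres in ℍⁿ⁺¹ centered at points of ∂'_∞ℍⁿ⁺¹ are subsolutions for conformal solitons with respect to −∂₀.) -/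
open Set Filter Topology

/-- The hemisphere `√(R² − |z − x₀|²)` is differentiable in the open ball, with explicit
differential. -/
theorem hasFDerivAt_hemisphere {E : Type*} [NormedAddCommGroup E] [InnerProductSpace ℝ E]
    {R : ℝ} {x₀ x : E} (hx : x ∈ Metric.ball x₀ R) :
    HasFDerivAt (fun z => Real.sqrt (R ^ 2 - ‖z - x₀‖ ^ 2))
      (-(Real.sqrt (R ^ 2 - ‖x - x₀‖ ^ 2))⁻¹ • innerSL ℝ (x - x₀)) x := by
  have hpos : 0 < R ^ 2 - ‖x - x₀‖ ^ 2 := by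
    rw [mem_ball_iff_norm] at hx
    nlinarith [norm_nonneg (x - x₀)]
  have h := ((((hasFDerivAt_id x).sub_const x₀).norm_sq).const_sub (R ^ 2)).sqrt hpos.ne'
  refine h.congr_fderiv ?_
  ext v
  simp
  ring

theorem pd_hemisphere {n : ℕ} {R : ℝ} {x₀ x : EuclideanSpace ℝ (Fin n)}
    (hx : x ∈ Metric.ball x₀ R) (i : Fin n) :
    pd n (fun z => Real.sqrt (R ^ 2 - ‖z - x₀‖ ^ 2)) i x =
      -(x i - x₀ i) / Real.sqrt (R ^ 2 - ‖x - x₀‖ ^ 2) := by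
  rw [pd, (hasFDerivAt_hemisphere hx).fderiv]
  simp [EuclideanSpace.inner_single_right]
  ring

theorem pd2_hemisphere {n : ℕ} {R : ℝ} {x₀ x : EuclideanSpace ℝ (Fin n)}
    (hx : x ∈ Metric.ball x₀ R) (i j : Fin n) :
    pd2 n (fun z => Real.sqrt (R ^ 2 - ‖z - x₀‖ ^ 2)) i j x =
      -(if i = j then 1 else 0) / Real.sqrt (R ^ 2 - ‖x - x₀‖ ^ 2) -
        (x i - x₀ i) * (x j - x₀ j) / Real.sqrt (R ^ 2 - ‖x - x₀‖ ^ 2) ^ 3 := by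
  have hu : Real.sqrt (R ^ 2 - ‖x - x₀‖ ^ 2) ≠ 0 := by
    rw [mem_ball_iff_norm] at hx
    exact (Real.sqrt_pos.2 (by nlinarith [norm_nonneg (x - x₀)])).ne'
  have heq : (fun y => fderiv ℝ (fun z => Real.sqrt (R ^ 2 - ‖z - x₀‖ ^ 2)) y
      (EuclideanSpace.single j 1)) =ᶠ[𝓝 x]
      fun y => -((y j - x₀ j) * (Real.sqrt (R ^ 2 - ‖y - x₀‖ ^ 2))⁻¹) := by
    filter_upwards [Metric.isOpen_ball.mem_nhds hx] with y hy
    have h := pd_hemisphere hy j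
    rw [pd] at h
    rw [h]
    ring
  have hcoord : HasFDerivAt (fun y : EuclideanSpace ℝ (Fin n) => y j - x₀ j)
      (EuclideanSpace.proj j : EuclideanSpace ℝ (Fin n) →L[ℝ] ℝ) x :=
    (EuclideanSpace.proj j : EuclideanSpace ℝ (Fin n) →L[ℝ] ℝ).hasFDerivAt.sub_const _
  have hinv : HasFDerivAt (fun y => (Real.sqrt (R ^ 2 - ‖y - x₀‖ ^ 2))⁻¹) _ x :=
    (hasDerivAt_inv hu).comp_hasFDerivAt x (hasFDerivAt_hemisphere hx)
  rw [pd2, heq.fderiv_eq, (hcoord.fun_mul hinv).fun_neg.fderiv]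
  simp [EuclideanSpace.inner_single_right, eq_comm]
  split_ifs <;> field_simp <;> ring

/-- Euclidean half-spheres centered at points of `∂'_∞ℍⁿ⁺¹` are
subsolutions of the soliton equation: `u(x) = √(R² − |x−x₀|²)` satisfies
`Δu − (D²u)(Du,Du)/(1+|Du|²) ≥ −(1+nu)/u²` on `B_R(x₀)`. -/
theorem hemisphere_is_subsolution (n : ℕ) (hn : 2 ≤ n)
    (R : ℝ) (hR : 0 < R) (x₀ : EuclideanSpace ℝ (Fin n)) :
    ∀ x ∈ Metric.ball x₀ R,
      -(1 + n * Real.sqrt (R ^ 2 - ‖x - x₀‖ ^ 2)) / (Real.sqrt (R ^ 2 - ‖x - x₀‖ ^ 2)) ^ 2 ≤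
        lap n (fun z => Real.sqrt (R ^ 2 - ‖z - x₀‖ ^ 2)) x -
          hessQuad n (fun z => Real.sqrt (R ^ 2 - ‖z - x₀‖ ^ 2)) x /
            (1 + gradNormSq n (fun z => Real.sqrt (R ^ 2 - ‖z - x₀‖ ^ 2)) x) := by
  intro x hx
  have hpos : 0 < R ^ 2 - ‖x - x₀‖ ^ 2 := by
    rw [mem_ball_iff_norm] at hx
    nlinarith [norm_nonneg (x - x₀)]
  have hu := Real.sqrt_pos.2 hpos
  simp only [lap, hessQuad, gradNormSq, pd_hemisphere hx, pd2_hemisphere hx]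
  generalize Real.sqrt (R ^ 2 - ‖x - x₀‖ ^ 2) = u at hu ⊢
  set s : ℝ := ∑ i, (x i - x₀ i) ^ 2 with hs
  have hgrad : ∑ i, (-(x i - x₀ i) / u) ^ 2 = s / u ^ 2 := by
    simp only [hs, div_pow, neg_sq, Finset.sum_div]
  have hlap : ∑ i : Fin n, (-(if True then (1 : ℝ) else 0) / u -
      (x i - x₀ i) * (x i - x₀ i) / u ^ 3) = -n / u - s / u ^ 3 := by
    simp only [if_true, Finset.sum_sub_distrib, ← Finset.sum_div, ← sq, ← hs]
    simp
  have hquad : ∑ i, ∑ j, (-(if i = j then (1 : ℝ) else 0) / u -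
      (x i - x₀ i) * (x j - x₀ j) / u ^ 3) * (-(x i - x₀ i) / u) * (-(x j - x₀ j) / u) =
        -(s / u ^ 3) * (1 + s / u ^ 2) := by
    have hterm : ∀ i j : Fin n, (-(if i = j then (1 : ℝ) else 0) / u -
        (x i - x₀ i) * (x j - x₀ j) / u ^ 3) * (-(x i - x₀ i) / u) * (-(x j - x₀ j) / u) =
        (if i = j then -((x i - x₀ i) ^ 2 / u ^ 3) else 0) -
          (x i - x₀ i) ^ 2 * (x j - x₀ j) ^ 2 / u ^ 5 := by
      intro i j
      split_ifs with h
      · subst h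
        field_simp
      · field_simp
        ring
    simp only [hterm, Finset.sum_sub_distrib, Finset.sum_ite_eq, Finset.mem_univ, if_true,
      Finset.sum_neg_distrib, ← Finset.sum_div, ← Finset.mul_sum, ← Finset.sum_mul, ← hs]
    field_simp
    ring
  have hs0 : 0 ≤ s := Finset.sum_nonneg fun i _ => sq_nonneg _
  have hden : 1 + s / u ^ 2 ≠ 0 := by positivity
  rw [hgrad, hlap, hquad, mul_div_cancel_right₀ _ hden]
  have hsplit : -(1 + n * u) / u ^ 2 = -n / u - 1 / u ^ 2 := by
    field_simp
    ring
  have hone : 0 < 1 / u ^ 2 := by positivity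
  rw [hsplit]
  linarith
end

section
/- Let n ≥ 2 and let φ be a C² solution of the grim-reaper ODE φ''(z)/(1+φ'(z)²) = ((nz+1)/z²)·φ'(z) on an interval (0,h) with φ' < 0 on (0,h), defined on its maximal interval of existence (i.e. φ cannot be extended as a solution past h). Then: (i) h < ∞; (ii) φ is strictly concave and φ'(z) → −∞ as z → h⁻ while φ'(z) → 0 as z → 0⁺; (iii) for all z ∈ (0,h), 1 + φ'(z)⁻² = (h/z)^{2n}·e^{2/z − 2/h}; (iv) φ has a finite limit φ(h⁻) and for all z ∈ (0,h), φ(z) − φ(h⁻) = ∫_z^h ((h/t)^{2n} e^{2/t − 2/h} − 1)^{−1/2} dt. -/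
open Set Filter Topology intervalIntegral

/-- The grim-reaper ODE `φ''/(1+(φ')²) = ((nz+1)/z²)·φ'` at `z`. -/
def GrimODE (n : ℕ) (φ : ℝ → ℝ) (z : ℝ) : Prop :=
  deriv (deriv φ) z / (1 + (deriv φ z) ^ 2) = (((n : ℝ) * z + 1) / z ^ 2) * deriv φ z

/-- The weight `z^{2n} e^{-2/z}`, the reciprocal of the first integral of the grim-reaper ODE. -/
noncomputable def grimWeight (n : ℕ) (z : ℝ) : ℝ := z ^ (2 * n) * Real.exp (-(2 / z))

/-- The negative slope determined by the first integral with value `C`. -/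
noncomputable def grimSlope (n : ℕ) (C z : ℝ) : ℝ := -(Real.sqrt (C / grimWeight n z - 1))⁻¹

theorem grimWeight_pos (n : ℕ) {z : ℝ} (hz : 0 < z) : 0 < grimWeight n z := by
  unfold grimWeight; positivity

theorem grimWeight_div (n : ℕ) (a z : ℝ) :
    (a / z) ^ (2 * n) * Real.exp (2 / z - 2 / a) = grimWeight n a / grimWeight n z := by
  rw [grimWeight, grimWeight, mul_div_mul_comm, ← div_pow, ← Real.exp_sub]
  ring_nf

theorem hasDerivAt_grimWeight (n : ℕ) {z : ℝ} (hz : z ≠ 0) :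
    HasDerivAt (grimWeight n) (2 * ((n * z + 1) / z ^ 2) * grimWeight n z) z := by
  have h1 : HasDerivAt (fun x : ℝ => -(2 / x)) (2 / z ^ 2) z := by
    simpa [div_eq_mul_inv] using (hasDerivAt_inv hz).const_mul (-2 : ℝ)
  refine ((hasDerivAt_pow (2 * n) z).mul h1.exp).congr_deriv ?_
  have h2 : ((2 * n : ℕ) : ℝ) * z ^ (2 * n - 1) * z = 2 * n * z ^ (2 * n) := by
    rcases n.eq_zero_or_pos with rfl | hn
    · simp
    · rw [mul_assoc, ← pow_succ, Nat.sub_add_cancel (by omega)]; push_cast; ring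
  have h3 : ((2 * n : ℕ) : ℝ) * z ^ (2 * n - 1) = 2 * n * z ^ (2 * n) / z :=
    eq_div_of_mul_eq hz h2
  rw [h3, grimWeight]
  field_simp

theorem strictMonoOn_grimWeight (n : ℕ) : StrictMonoOn (grimWeight n) (Ioi 0) := by
  refine strictMonoOn_of_deriv_pos (convex_Ioi 0) (fun z hz =>
    (hasDerivAt_grimWeight n (ne_of_gt hz)).continuousAt.continuousWithinAt) fun z hz => ?_
  rw [interior_Ioi] at hz
  have hz : 0 < z := hz
  rw [(hasDerivAt_grimWeight n hz.ne').deriv]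
  have := grimWeight_pos n hz
  positivity

theorem exists_lt_grimWeight {n : ℕ} (hn : n ≠ 0) (C : ℝ) : ∃ z, 0 < z ∧ C < grimWeight n z := by
  refine ⟨max 1 ((C + 1) * Real.exp 2), by positivity, ?_⟩
  set z := max 1 ((C + 1) * Real.exp 2)
  have h1 : 1 ≤ z := le_max_left _ _
  have h2 : (C + 1) * Real.exp 2 ≤ z := le_max_right _ _
  have h3 : z ≤ z ^ (2 * n) := le_self_pow₀ h1 (by omega)
  have h4 : Real.exp (-2) ≤ Real.exp (-(2 / z)) :=
    Real.exp_le_exp.2 (neg_le_neg (div_le_self (by norm_num) h1))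
  calc C < C + 1 := by linarith
    _ = (C + 1) * Real.exp 2 * Real.exp (-2) := by rw [mul_assoc, ← Real.exp_add]; simp
    _ ≤ z ^ (2 * n) * Real.exp (-(2 / z)) :=
      mul_le_mul (h2.trans h3) h4 (Real.exp_pos _).le (by positivity)

theorem tendsto_grimWeight_zero {n : ℕ} (hn : n ≠ 0) :
    Tendsto (grimWeight n) (𝓝[>] 0) (𝓝[>] 0) := by
  refine tendsto_nhdsWithin_of_tendsto_nhds_of_eventually_within _ ?_
    (eventually_mem_nhdsWithin.mono fun z hz => grimWeight_pos n hz)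
  have h1 : Tendsto (fun z : ℝ => z ^ (2 * n)) (𝓝[>] 0) (𝓝 0) := by
    have : ContinuousAt (fun z : ℝ => z ^ (2 * n)) 0 := by fun_prop
    simpa [ContinuousAt, hn] using this.tendsto.mono_left (nhdsWithin_le_nhds (s := Ioi 0))
  refine squeeze_zero' (eventually_mem_nhdsWithin.mono fun z hz => (grimWeight_pos n hz).le)
    (eventually_mem_nhdsWithin.mono fun z hz => ?_) h1
  have hz : 0 < z := hz
  exact mul_le_of_le_one_right (by positivity) (Real.exp_le_one_iff.2 (by simp; positivity))

theorem hasDerivAt_grimSlope (n : ℕ) {C z : ℝ} (hz : 0 < z) (hC : grimWeight n z < C) :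
    HasDerivAt (grimSlope n C)
      ((1 + grimSlope n C z ^ 2) * ((n * z + 1) / z ^ 2 * grimSlope n C z)) z := by
  have hE := grimWeight_pos n hz
  have hF : 0 < C / grimWeight n z - 1 := sub_pos.2 ((one_lt_div hE).2 hC)
  have h1 : HasDerivAt (fun x => C / grimWeight n x - 1)
      (-(2 * ((n * z + 1) / z ^ 2) * (C / grimWeight n z))) z := by
    refine (((hasDerivAt_const z C).div (hasDerivAt_grimWeight n hz.ne') hE.ne').sub_const
      1).congr_deriv ?_
    field_simp
    simp
  have hs := Real.sqrt_pos.2 hF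
  refine ((h1.sqrt hF.ne').fun_inv hs.ne').fun_neg.congr_deriv ?_
  have hsq : C / grimWeight n z = Real.sqrt (C / grimWeight n z - 1) ^ 2 + 1 := by
    rw [Real.sq_sqrt hF.le]; ring
  rw [grimSlope]
  set s := Real.sqrt (C / grimWeight n z - 1)
  rw [hsq]
  field_simp

theorem contDiffAt_grimSlope (n : ℕ) {C z : ℝ} (hz : 0 < z) (hC : grimWeight n z < C) :
    ContDiffAt ℝ 1 (grimSlope n C) z := by
  have hE := grimWeight_pos n hz
  have hF : 0 < C / grimWeight n z - 1 := sub_pos.2 ((one_lt_div hE).2 hC)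
  have h1 : ContDiffAt ℝ 1 (grimWeight n) z :=
    (contDiffAt_id.pow _).mul (contDiffAt_const.div contDiffAt_id hz.ne').neg.exp
  exact (((contDiffAt_const.div h1 hE.ne').sub contDiffAt_const).sqrt hF.ne').inv
    (Real.sqrt_pos.2 hF).ne' |>.neg

theorem intervalIntegrable_grimSlope (n : ℕ) {a z : ℝ} (hz : 0 < z) (hza : z ≤ a) :
    IntervalIntegrable (grimSlope n (grimWeight n a)) MeasureTheory.volume z a := by
  have ha : 0 < a := hz.trans_le hza
  have h1 : IntervalIntegrable (fun t : ℝ => a * (a - t) ^ (-(1 / 2) : ℝ))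
      MeasureTheory.volume z a := by
    have := (intervalIntegrable_rpow' (a := a - z) (b := 0) (r := -(1 / 2))
      (by norm_num)).comp_sub_left a
    simpa using this.const_mul a
  refine h1.mono_fun ?_ ?_
  · apply Measurable.aestronglyMeasurable
    unfold grimSlope grimWeight
    fun_prop
  · rw [uIoc_of_le hza]
    filter_upwards [MeasureTheory.ae_restrict_mem measurableSet_Ioc] with t ht
    rcases eq_or_lt_of_le ht.2 with rfl | hta
    · simp [grimSlope, div_self (grimWeight_pos n ha).ne']
    have ht0 : 0 < t := hz.trans ht.1
    have hat : 0 < a - t := sub_pos.2 hta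
    have h2 : (a - t) / a ^ 2 ≤ grimWeight n a / grimWeight n t - 1 := by
      rw [← grimWeight_div]
      have h3 : 1 ≤ (a / t) ^ (2 * n) := one_le_pow₀ ((one_le_div ht0).2 hta.le)
      have h4 := Real.add_one_le_exp (2 / t - 2 / a)
      have h5 : (a - t) / a ^ 2 ≤ 2 / t - 2 / a := by
        rw [div_sub_div _ _ ht0.ne' ha.ne', div_le_div_iff₀ (by positivity) (by positivity)]
        nlinarith [mul_pos hat (mul_pos ha hat), mul_pos hat (mul_pos ha ha)]
      have h6 := le_mul_of_one_le_left (Real.exp_pos (2 / t - 2 / a)).le h3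
      linarith
    have h7 : Real.sqrt (a - t) / a ≤ Real.sqrt (grimWeight n a / grimWeight n t - 1) := by
      have := Real.sqrt_le_sqrt h2
      rwa [Real.sqrt_div hat.le, Real.sqrt_sq ha.le] at this
    have h8 : 0 < Real.sqrt (a - t) / a := div_pos (Real.sqrt_pos.2 hat) ha
    rw [grimSlope, norm_neg, Real.norm_of_nonneg (by positivity),
      Real.norm_of_nonneg (by positivity), Real.rpow_neg hat.le, ← Real.sqrt_eq_rpow]
    calc _ ≤ (Real.sqrt (a - t) / a)⁻¹ := inv_anti₀ h8 h7
      _ = _ := by rw [inv_div, div_eq_mul_inv]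

theorem tendsto_grimSlope_zero {n : ℕ} (hn : n ≠ 0) {C : ℝ} (hC : 0 < C) :
    Tendsto (grimSlope n C) (𝓝[>] 0) (𝓝 0) := by
  have h1 := (tendsto_inv_nhdsGT_zero.comp (tendsto_grimWeight_zero hn)).const_mul_atTop hC
  have h2 := tendsto_atTop_add_const_right _ (-1) h1
  simpa [show grimSlope n C = fun z => -(Real.sqrt (C / grimWeight n z - 1))⁻¹ from rfl,
    div_eq_mul_inv, sub_eq_add_neg, Function.comp_def] using
    (Real.tendsto_sqrt_atTop.comp h2).inv_tendsto_atTop.neg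

theorem tendsto_grimSlope_atBot (n : ℕ) {a : ℝ} (ha : 0 < a) :
    Tendsto (grimSlope n (grimWeight n a)) (𝓝[<] a) atBot := by
  have hE := grimWeight_pos n ha
  refine tendsto_neg_atTop_atBot.comp (tendsto_inv_nhdsGT_zero.comp ?_)
  refine tendsto_nhdsWithin_of_tendsto_nhds_of_eventually_within _ ?_ ?_
  · have h1 : ContinuousAt (fun z => Real.sqrt (grimWeight n a / grimWeight n z - 1)) a :=
      ((continuousAt_const.div (hasDerivAt_grimWeight n ha.ne').continuousAt hE.ne').sub
        continuousAt_const).sqrt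
    simpa [ContinuousAt, div_self hE.ne'] using
      h1.tendsto.mono_left (nhdsWithin_le_nhds (s := Iio a))
  · filter_upwards [Ioo_mem_nhdsLT ha] with z hz
    exact Real.sqrt_pos.2 (sub_pos.2 ((one_lt_div (grimWeight_pos n hz.1)).2
      (strictMonoOn_grimWeight n hz.1 ha hz.2)))

/-- The primitive of `grimSlope` solves the grim-reaper ODE where the slope is finite. -/
theorem grimODE_integral_grimSlope (n : ℕ) {C a b c : ℝ} (ha : a ∈ Ioo 0 b)
    (hb : grimWeight n b ≤ C) {z : ℝ} (hz : z ∈ Ioo 0 b) :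
    ContDiffAt ℝ 2 (fun x => c + ∫ t in a..x, grimSlope n C t) z ∧
      GrimODE n (fun x => c + ∫ t in a..x, grimSlope n C t) z := by
  set ψ : ℝ → ℝ := fun x => c + ∫ t in a..x, grimSlope n C t
  have hlt : ∀ x ∈ Ioo 0 b, grimWeight n x < C := fun x hx =>
    (strictMonoOn_grimWeight n hx.1 (hx.1.trans hx.2) hx.2).trans_le hb
  have hcd : ContDiffOn ℝ 1 (grimSlope n C) (Ioo 0 b) := fun x hx =>
    (contDiffAt_grimSlope n hx.1 (hlt x hx)).contDiffWithinAt
  have hψ : ∀ x ∈ Ioo 0 b, HasDerivAt ψ (grimSlope n C x) x := by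
    intro x hx
    refine HasDerivAt.const_add c (integral_hasDerivAt_right ?_ ?_ ?_)
    · exact (hcd.continuousOn.mono (ordConnected_Ioo.uIcc_subset ha hx)).intervalIntegrable
    · exact hcd.continuousOn.stronglyMeasurableAtFilter isOpen_Ioo x hx
    · exact hcd.continuousOn.continuousAt (isOpen_Ioo.mem_nhds hx)
  have heq : EqOn (deriv ψ) (grimSlope n C) (Ioo 0 b) := fun x hx => (hψ x hx).deriv
  constructor
  · refine ContDiffOn.contDiffAt (s := Ioo 0 b) ?_ (isOpen_Ioo.mem_nhds hz)
    rw [show (2 : WithTop ℕ∞) = 1 + 1 by norm_num, contDiffOn_succ_iff_deriv_of_isOpen isOpen_Ioo]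
    exact ⟨fun x hx => (hψ x hx).differentiableAt.differentiableWithinAt, by simp,
      hcd.congr heq⟩
  · have h2 := (hasDerivAt_grimSlope n hz.1 (hlt z hz)).congr_of_eventuallyEq
      (heq.eventuallyEq_of_mem (isOpen_Ioo.mem_nhds hz))
    have h3 : 0 < 1 + grimSlope n C z ^ 2 := by positivity
    rw [GrimODE, h2.deriv, heq hz, mul_div_cancel_left₀ _ h3.ne']

/-- The first integral of the grim-reaper ODE, solved for the slope. -/
theorem exists_deriv_eq_grimSlope (n : ℕ) {s : Set ℝ} (hs : IsOpen s) (hc : s.OrdConnected)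
    (hne : s.Nonempty) (h0 : s ⊆ Ioi 0) {φ : ℝ → ℝ} (hreg : ContDiffOn ℝ 2 φ s)
    (hode : ∀ z ∈ s, GrimODE n φ z) (hdec : ∀ z ∈ s, deriv φ z < 0) :
    ∃ C, ∀ z ∈ s, grimWeight n z < C ∧ deriv φ z = grimSlope n C z ∧
      1 + (deriv φ z ^ 2)⁻¹ = C / grimWeight n z := by
  have hd : ∀ z ∈ s, HasDerivAt (deriv φ) (deriv (deriv φ) z) z := by
    rw [show (2 : WithTop ℕ∞) = 1 + 1 by norm_num, contDiffOn_succ_iff_deriv_of_isOpen hs] at hreg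
    exact fun z hz =>
      ((hreg.2.2.differentiableOn one_ne_zero).differentiableAt (hs.mem_nhds hz)).hasDerivAt
  have hG : ∀ z ∈ s, HasDerivAt (fun x => (1 + (deriv φ x ^ 2)⁻¹) * grimWeight n x) 0 z := by
    intro z hz
    have hz0 : 0 < z := h0 hz
    have hp := (hdec z hz).ne
    refine (((((hd z hz).fun_pow 2).fun_inv (pow_ne_zero 2 hp)).const_add 1).mul
      (hasDerivAt_grimWeight n hz0.ne')).congr_deriv ?_
    have h1 : deriv (deriv φ) z =
        (n * z + 1) / z ^ 2 * deriv φ z * (1 + deriv φ z ^ 2) :=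
      (div_eq_iff (by positivity)).1 (hode z hz)
    rw [h1]
    field_simp
    ring
  obtain ⟨a, ha⟩ := hne
  refine ⟨(1 + (deriv φ a ^ 2)⁻¹) * grimWeight n a, fun z hz => ?_⟩
  have hconst := hs.is_const_of_deriv_eq_zero hc.isPreconnected
    (fun x hx => (hG x hx).differentiableAt.differentiableWithinAt)
    (fun x hx => (hG x hx).deriv) hz ha
  have hE := grimWeight_pos n (h0 hz)
  have hp := hdec z hz
  have hp2 : 0 < (deriv φ z ^ 2)⁻¹ := inv_pos.2 (sq_pos_of_neg hp)
  have hC := eq_div_of_mul_eq hE.ne' hconst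
  refine ⟨?_, ?_, hC⟩
  · rw [← hconst]
    nlinarith
  · rw [grimSlope, ← hC, add_sub_cancel_left, Real.sqrt_inv, inv_inv, Real.sqrt_sq_eq_abs,
      abs_of_neg hp, neg_neg]

/-- qualitative behaviour of a maximal decreasing solution of the
grim-reaper ODE on `(0,h)`: the maximal time `h` is finite, `φ` is strictly concave,
`φ' → −∞` at `h⁻`, `φ' → 0` at `0⁺`, the first integral
`1 + φ'(z)⁻² = (h/z)^{2n} e^{2/z−2/h}` holds, and `φ` has a finite limit at `h⁻`
given by the explicit integral formula. -/
theorem grim_reaper_profile (n : ℕ) (hn : 2 ≤ n) (h : EReal) (hpos : (0 : EReal) < h)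
    (φ : ℝ → ℝ)
    (hreg : ∀ z : ℝ, 0 < z → (z : EReal) < h → ContDiffAt ℝ 2 φ z)
    (hode : ∀ z : ℝ, 0 < z → (z : EReal) < h → GrimODE n φ z)
    (hdec : ∀ z : ℝ, 0 < z → (z : EReal) < h → deriv φ z < 0)
    (hmax : ¬ ∃ (h' : EReal) (ψ : ℝ → ℝ), h < h' ∧
        (∀ z : ℝ, 0 < z → (z : EReal) < h → ψ z = φ z) ∧
        ∀ z : ℝ, 0 < z → (z : EReal) < h' → ContDiffAt ℝ 2 ψ z ∧ GrimODE n ψ z) :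
    ∃ hr : ℝ, h = (hr : EReal) ∧ 0 < hr ∧
      (∀ z ∈ Set.Ioo 0 hr, deriv (deriv φ) z < 0) ∧
      Tendsto (deriv φ) (𝓝[<] hr) atBot ∧
      Tendsto (deriv φ) (𝓝[>] 0) (𝓝 0) ∧
      (∀ z ∈ Set.Ioo 0 hr,
        1 + ((deriv φ z) ^ 2)⁻¹ = (hr / z) ^ (2 * n) * Real.exp (2 / z - 2 / hr)) ∧
      ∃ L : ℝ, Tendsto φ (𝓝[<] hr) (𝓝 L) ∧
        ∀ z ∈ Set.Ioo 0 hr,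
          φ z - L = ∫ t in z..hr,
            (Real.sqrt ((hr / t) ^ (2 * n) * Real.exp (2 / t - 2 / hr) - 1))⁻¹ := by
  set s : Set ℝ := {z | 0 < z ∧ (z : EReal) < h}
  have hs : IsOpen s :=
    isOpen_Ioi.inter (isOpen_Iio.preimage continuous_coe_real_ereal)
  have hc : s.OrdConnected :=
    ⟨fun x hx y hy z hz => ⟨hx.1.trans_le hz.1, (EReal.coe_le_coe_iff.2 hz.2).trans_lt hy.2⟩⟩
  have hne : s.Nonempty := by
    obtain ⟨x, hx0, hx⟩ := EReal.lt_iff_exists_real_btwn.1 hpos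
    exact ⟨x, EReal.coe_pos.1 hx0, hx⟩
  have hn0 : n ≠ 0 := by omega
  obtain ⟨C, hC⟩ := exists_deriv_eq_grimSlope n hs hc hne (fun z hz => hz.1)
    (fun z hz => (hreg z hz.1 hz.2).contDiffWithinAt) (fun z hz => hode z hz.1 hz.2)
    (fun z hz => hdec z hz.1 hz.2)
  have htop : h ≠ ⊤ := by
    rintro rfl
    obtain ⟨z, hz, hCz⟩ := exists_lt_grimWeight hn0 C
    exact (hC z ⟨hz, EReal.coe_lt_top z⟩).1.not_gt hCz
  lift h to ℝ using ⟨htop, (bot_lt_of_lt hpos).ne'⟩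
  have h0 : 0 < h := EReal.coe_pos.1 hpos
  have hsI : s = Ioo 0 h := by ext z; simp [s]
  clear_value s
  subst hsI
  simp only [EReal.coe_lt_coe_iff] at hreg hode hdec
  have hφ : ∀ z ∈ Ioo 0 h, HasDerivAt φ (grimSlope n C z) z := fun z hz =>
    (hC z hz).2.1 ▸ ((hreg z hz.1 hz.2).differentiableAt two_ne_zero).hasDerivAt
  have hcont : ContinuousOn (grimSlope n C) (Ioo 0 h) := fun z hz =>
    (hasDerivAt_grimSlope n hz.1 (hC z hz).1).continuousAt.continuousWithinAt
  have hftc : ∀ a ∈ Ioo 0 h, ∀ z ∈ Ioo 0 h, ∫ t in a..z, grimSlope n C t = φ z - φ a := by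
    intro a ha z hz
    have hsub := ordConnected_Ioo.uIcc_subset ha hz
    exact integral_eq_sub_of_hasDerivAt (fun t ht => hφ t (hsub ht))
      (hcont.mono hsub).intervalIntegrable
  obtain ⟨a, ha⟩ := hne
  have hEC : C = grimWeight n h := by
    have hEcont := (hasDerivAt_grimWeight n h0.ne').continuousAt
    refine le_antisymm ?_ ?_
    · by_contra! hlt
      have hev := (hEcont.tendsto.mono_left (nhdsWithin_le_nhds (s := Ioi h))).eventually_lt_const
        hlt
      obtain ⟨b, hbC, hb⟩ := (hev.and eventually_mem_nhdsWithin).exists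
      have hb : h < b := hb
      refine hmax ⟨b, fun x => φ a + ∫ t in a..x, grimSlope n C t,
        EReal.coe_lt_coe_iff.2 hb, ?_, ?_⟩
      · intro z hz0 hz
        simp only [hftc a ha z ⟨hz0, EReal.coe_lt_coe_iff.1 hz⟩]
        ring
      · intro z hz0 hz
        exact grimODE_integral_grimSlope n ⟨ha.1, ha.2.trans hb⟩ hbC.le
          ⟨hz0, EReal.coe_lt_coe_iff.1 hz⟩
    · refine le_of_tendsto (hEcont.tendsto.mono_left (nhdsWithin_le_nhds (s := Iio h))) ?_
      filter_upwards [Ioo_mem_nhdsLT h0] with z hz using (hC z hz).1.le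
  subst hEC
  refine ⟨h, rfl, h0, ?_, ?_, ?_, ?_, ?_⟩
  · intro z hz
    have h1 := (div_eq_iff (by positivity)).1 (hode z hz.1 hz.2)
    rw [h1]
    have hz0 := hz.1
    exact mul_neg_of_neg_of_pos (mul_neg_of_pos_of_neg (by positivity) (hdec z hz.1 hz.2))
      (by positivity)
  · refine (tendsto_grimSlope_atBot n h0).congr' ?_
    filter_upwards [Ioo_mem_nhdsLT h0] with z hz using (hC z hz).2.1.symm
  · refine (tendsto_grimSlope_zero hn0 (grimWeight_pos n h0)).congr' ?_
    filter_upwards [Ioo_mem_nhdsGT h0] with z hz using (hC z hz).2.1.symm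
  · intro z hz
    rw [grimWeight_div, (hC z hz).2.2]
  · have hint := intervalIntegrable_grimSlope n ha.1 ha.2.le
    refine ⟨φ a + ∫ t in a..h, grimSlope n (grimWeight n h) t, ?_, ?_⟩
    · have h1 : ContinuousWithinAt (fun x => ∫ t in a..x, grimSlope n (grimWeight n h) t)
          (Icc a h) h :=
        (continuousOn_primitive_interval' hint left_mem_uIcc).mono Icc_subset_uIcc h
          (right_mem_Icc.2 ha.2.le)
      have h2 := (h1.tendsto.mono_left (nhdsWithin_mono h Ioo_subset_Icc_self)).const_add (φ a)
      rw [nhdsWithin_Ioo_eq_nhdsLT ha.2] at h2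
      refine h2.congr' ?_
      filter_upwards [Ioo_mem_nhdsLT h0] with z hz
      rw [hftc a ha z hz]
      ring
    · intro z hz
      have h1 := integral_interval_sub_left hint
        (hcont.mono (ordConnected_Ioo.uIcc_subset ha hz)).intervalIntegrable
      have h2 : (∫ t in z..h, grimSlope n (grimWeight n h) t) =
          -∫ t in z..h, (Real.sqrt ((h / t) ^ (2 * n) * Real.exp (2 / t - 2 / h) - 1))⁻¹ := by
        simp only [grimSlope, integral_neg, grimWeight_div]
      have h3 := hftc a ha z hz
      linarith
end

section
/- Let n ≥ 2 and let φ be a positive C² solution of the rotational soliton ODE z·φ''/(1+(φ')²) − ((1+nz)/z)·φ' − (n−1)z/φ = 0 defined in a neighbourhood of a point z₀ > 0, with φ'(z₀) < 0 and φ''(z₀) ≤ 0. Then φ extends to a positive solution on (0, z₀] with φ' < 0 and φ'' < 0 on (0, z₀); moreover φ extends to a C¹ function on [0, z₀] with φ(0) > 0 and φ'(0) = 0, and φ(z) = φ(0) − ((n−1)/(3·φ(0)))·z³ + o(z³) as z → 0⁺. -/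
open Set Filter Topology Asymptotics

/-- The rotational soliton ODE `z·φ''/(1+(φ')²) − ((1+nz)/z)·φ' − (n−1)z/φ = 0` at `z`. -/
def RotODE (n : ℕ) (φ : ℝ → ℝ) (z : ℝ) : Prop :=
  z * deriv (deriv φ) z / (1 + (deriv φ z) ^ 2) -
    ((1 + (n : ℝ) * z) / z) * deriv φ z - ((n : ℝ) - 1) * z / φ z = 0

/-- If `f b ≤ 0` and `f` has positive derivative at each zero `x ≤ b` to the right of which it is
negative, then `f` is negative to the left of `b`. -/
theorem neg_of_pos_hasDerivAt_at_zeros {f : ℝ → ℝ} {a b : ℝ}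
    (hf : ContinuousOn f (Icc a b)) (hb : f b ≤ 0)
    (h : ∀ x ∈ Icc a b, f x = 0 → (∀ y ∈ Ioo x b, f y < 0) → ∃ d > 0, HasDerivAt f d x) :
    ∀ y ∈ Ico a b, f y < 0 := by
  intro y hy
  by_contra! hfy
  have hab : a < b := hy.1.trans_lt hy.2
  have hleft : ∀ᶠ t in 𝓝[<] b, f t < 0 := by
    rcases hb.lt_or_eq with hb | hb
    · have h1 : ContinuousWithinAt f (Iio b) b :=
        (hf b ⟨hab.le, le_rfl⟩).mono_of_mem_nhdsWithin (Icc_mem_nhdsLT hab)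
      exact h1.eventually_lt_const hb
    · obtain ⟨d, hd, hfd⟩ := h b ⟨hab.le, le_rfl⟩ hb (by simp)
      have := (hasDerivAt_iff_tendsto_slope_left_right.1 hfd).1.eventually_const_lt hd
      filter_upwards [this, self_mem_nhdsWithin] with t ht htb
      rw [slope_def_field, hb] at ht
      have htb : t - b < 0 := sub_neg.2 htb
      rw [sub_zero] at ht
      by_contra! h0
      exact absurd ht (not_lt.2 (div_nonpos_of_nonneg_of_nonpos h0 htb.le))
  obtain ⟨c, hcb, hc⟩ := (mem_nhdsLT_iff_exists_Ioo_subset).1 hleft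
  have hcb : c < b := hcb
  have hyc : max c y < b := max_lt hcb hy.2
  have hcpt : IsCompact (Icc y (max c y) ∩ f ⁻¹' Ici 0) := by
    refine isCompact_Icc.of_isClosed_subset ?_ inter_subset_left
    exact (hf.mono (Icc_subset_Icc hy.1 hyc.le)).preimage_isClosed_of_isClosed isClosed_Icc
      isClosed_Ici
  obtain ⟨x, ⟨hx, hfx⟩, hxm⟩ := hcpt.exists_isGreatest ⟨y, ⟨le_rfl, le_max_right _ _⟩, hfy⟩
  have hfx : 0 ≤ f x := hfx
  have hxb : x < b := hx.2.trans_lt hyc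
  have hneg : ∀ t ∈ Ioo x b, f t < 0 := by
    intro t ht
    by_contra! h0
    rcases le_or_gt t (max c y) with htc | htc
    · exact absurd (hxm ⟨⟨hx.1.trans ht.1.le, htc⟩, h0⟩) (not_le.2 ht.1)
    · exact absurd (hc ⟨(le_max_left _ _).trans_lt htc, ht.2⟩) (not_lt.2 h0)
  have hev : ∀ᶠ t in 𝓝[>] x, f t < 0 := by
    filter_upwards [Ioo_mem_nhdsGT hxb] with t ht using hneg t ht
  have hxab : x ∈ Icc a b := ⟨hy.1.trans hx.1, hxb.le⟩
  have hx0 : f x = 0 := by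
    refine le_antisymm ?_ hfx
    have h1 : ContinuousWithinAt f (Ioi x) x :=
      (hf x hxab).mono_of_mem_nhdsWithin
        (mem_of_superset (Icc_mem_nhdsGT hxb) (Icc_subset_Icc_left hxab.1))
    exact le_of_tendsto h1 (hev.mono fun _ h => h.le)
  obtain ⟨d, hd, hfd⟩ := h x hxab hx0 hneg
  have h2 := (hasDerivAt_iff_tendsto_slope_left_right.1 hfd).2.eventually_const_lt hd
  obtain ⟨t, ⟨ht1, ht2⟩, ht3⟩ := ((h2.and hev).and self_mem_nhdsWithin).exists
  rw [slope_def_field, hx0, sub_zero] at ht1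
  have ht3 : 0 < t - x := sub_pos.2 ht3
  exact absurd ht1 (not_lt.2 (div_nonpos_of_nonpos_of_nonneg ht2.le ht3.le))

open scoped NNReal in
/-- A time-dependent vector field on `(0, ∞)` which is, locally uniformly in time, bounded and
globally Lipschitz has a solution on all of `(0, ∞)`. -/
theorem exists_forall_pos_hasDerivAt {E : Type*} [NormedAddCommGroup E] [NormedSpace ℝ E]
    [CompleteSpace E] {v : ℝ → E → E} {t₀ : ℝ} (ht₀ : 0 < t₀) (x₀ : E)
    (hlip : ∀ a b : ℝ, 0 < a → ∃ K : ℝ≥0, ∀ t ∈ Icc a b, LipschitzWith K (v t))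
    (hbd : ∀ a b : ℝ, 0 < a → ∃ L : ℝ≥0, ∀ t ∈ Icc a b, ∀ x, ‖v t x‖ ≤ L)
    (hcont : ∀ x, ContinuousOn (fun t => v t x) (Ioi 0)) :
    ∃ α : ℝ → E, α t₀ = x₀ ∧ ∀ t > 0, HasDerivAt α (v t (α t)) t := by
  have key : ∀ a b : ℝ, 0 < a → a < t₀ → t₀ < b → ∃ β : ℝ → E, β t₀ = x₀ ∧
      ∀ t ∈ Ioo a b, HasDerivAt β (v t (β t)) t := by
    intro a b ha hat hbt
    obtain ⟨K, hK⟩ := hlip a b ha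
    obtain ⟨L, hL⟩ := hbd a b ha
    have hp : IsPicardLindelof v (⟨t₀, hat.le, hbt.le⟩ : Icc a b) x₀
        (L * (max (b - t₀) (t₀ - a)).toNNReal) 0 L K :=
      { lipschitzOnWith := fun t ht => (hK t ht).lipschitzOnWith
        continuousOn := fun x _ => (hcont x).mono fun t ht => ha.trans_le ht.1
        norm_le := fun t ht x _ => hL t ht x
        mul_max_le := by
          have : 0 ≤ max (b - t₀) (t₀ - a) := le_max_of_le_left (by linarith)
          simp [Real.coe_toNNReal _ this] }
    obtain ⟨β, h0, hβ⟩ := hp.exists_eq_forall_mem_Icc_hasDerivWithinAt₀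
    exact ⟨β, h0, fun t ht => (hβ t ⟨ht.1.le, ht.2.le⟩).hasDerivAt (Icc_mem_nhds ht.1 ht.2)⟩
  have key' : ∀ s : ℝ, ∃ β : ℝ → E, 0 < s → β t₀ = x₀ ∧
      ∀ t ∈ Ioo (min s t₀ / 2) (max s t₀ + 1), HasDerivAt β (v t (β t)) t := by
    intro s
    by_cases hs : 0 < s
    · have hm : 0 < min s t₀ := lt_min hs ht₀
      obtain ⟨β, hβ⟩ := key (min s t₀ / 2) (max s t₀ + 1) (by linarith)
        (by linarith [min_le_right s t₀]) (by linarith [le_max_right s t₀])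
      exact ⟨β, fun _ => hβ⟩
    · exact ⟨fun _ => 0, fun h => absurd h hs⟩
  choose β hβ using key'
  have hmem : ∀ s > 0, s ∈ Ioo (min s t₀ / 2) (max s t₀ + 1) := fun s hs =>
    ⟨by linarith [min_le_left s t₀], by linarith [le_max_left s t₀]⟩
  have hmem₀ : ∀ s > 0, t₀ ∈ Ioo (min s t₀ / 2) (max s t₀ + 1) := fun s hs =>
    ⟨by linarith [min_le_right s t₀], by linarith [le_max_right s t₀]⟩
  have heq : ∀ s > 0, ∀ t ∈ Ioo (min s t₀ / 2) (max s t₀ + 1), β t t = β s t := by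
    intro s hs t ht
    have hs2 : 0 < min s t₀ / 2 := by have := lt_min hs ht₀; linarith
    have ht0 : 0 < t := hs2.trans ht.1
    have ht2 : 0 < min t t₀ / 2 := by have := lt_min ht0 ht₀; linarith
    set a := max (min s t₀ / 2) (min t t₀ / 2)
    set b := min (max s t₀ + 1) (max t t₀ + 1)
    obtain ⟨K, hK⟩ := hlip a b (hs2.trans_le (le_max_left _ _))
    refine ODE_solution_unique_of_mem_Ioo (v := v) (s := fun _ => univ) (K := K) (a := a) (b := b)
      (t₀ := t₀)
      (fun t ht => (hK t ⟨ht.1.le, ht.2.le⟩).lipschitzOnWith)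
      ⟨max_lt (hmem₀ s hs).1 (hmem₀ t ht0).1, lt_min (hmem₀ s hs).2 (hmem₀ t ht0).2⟩
      (fun r hr => ⟨(hβ t ht0).2 r ?_, mem_univ _⟩) (fun r hr => ⟨(hβ s hs).2 r ?_, mem_univ _⟩)
      (((hβ t ht0).1).trans ((hβ s hs).1).symm)
      ⟨max_lt ht.1 (hmem t ht0).1, lt_min ht.2 (hmem t ht0).2⟩
    · exact ⟨(le_max_right _ _).trans_lt hr.1, hr.2.trans_le (min_le_right _ _)⟩
    · exact ⟨(le_max_left _ _).trans_lt hr.1, hr.2.trans_le (min_le_left _ _)⟩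
  refine ⟨fun t => β t t, (hβ t₀ ht₀).1, fun s hs => ?_⟩
  refine ((hβ s hs).2 s (hmem s hs)).congr_of_eventuallyEq ?_
  filter_upwards [isOpen_Ioo.mem_nhds (hmem s hs)] with t ht using heq s hs t ht

/-- If `ψ' = p` and `p z = -c z² + o(z²)`, then `ψ z = ψ 0 - c z³ / 3 + o(z³)`. -/
theorem isLittleO_cube_of_hasDerivAt {ψ p : ℝ → ℝ} {c : ℝ}
    (hc : ContinuousWithinAt ψ (Ici 0) 0) (hψ : ∀ᶠ z in 𝓝[>] (0 : ℝ), HasDerivAt ψ (p z) z)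
    (hp : ∀ ε > 0, ∀ᶠ z in 𝓝[>] (0 : ℝ), |p z + c * z ^ 2| ≤ ε * z ^ 2) :
    (fun z => ψ z - (ψ 0 - c / 3 * z ^ 3)) =o[𝓝[>] (0 : ℝ)] fun z => z ^ 3 := by
  refine isLittleO_iff.2 fun ε hε => ?_
  obtain ⟨δ, hδ, hsub⟩ := mem_nhdsGT_iff_exists_Ioo_subset.1 (hψ.and (hp ε hε))
  filter_upwards [Ioo_mem_nhdsGT hδ] with z hz
  have hz0 : 0 < z := hz.1
  set h : ℝ → ℝ := fun z => ψ z - (ψ 0 - c / 3 * z ^ 3)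
  have hd : ∀ x ∈ Ioo 0 z, HasDerivAt h (p x + c * x ^ 2) x := by
    intro x hx
    have h1 := (hsub ⟨hx.1, hx.2.trans hz.2⟩).1
    have h2 := h1.sub (((hasDerivAt_pow 3 x).const_mul (c / 3)).const_sub (ψ 0))
    refine h2.congr_deriv ?_
    norm_num
    ring
  have hcont : ContinuousOn h (Icc 0 z) := by
    intro x hx
    rcases hx.1.eq_or_lt with rfl | hx0
    · have : ContinuousWithinAt h (Ici 0) 0 := by
        refine hc.sub (Continuous.continuousWithinAt (by fun_prop))
      exact this.mono Icc_subset_Ici_self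
    · have h1 := (hsub ⟨hx0, hx.2.trans_lt hz.2⟩).1.continuousAt
      exact ContinuousAt.continuousWithinAt (h1.sub (by fun_prop))
  obtain ⟨x, hx, hxe⟩ := exists_hasDerivAt_eq_slope h _ hz0 hcont hd
  have h0 : h 0 = 0 := by simp [h]
  rw [h0, sub_zero, sub_zero, eq_div_iff hz0.ne'] at hxe
  have hb := (hsub ⟨hx.1, hx.2.trans hz.2⟩).2
  change ‖h z‖ ≤ _
  rw [← hxe, Real.norm_eq_abs, Real.norm_eq_abs, abs_mul, abs_of_pos hz0,
    abs_of_pos (pow_pos hz0 3)]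
  have hx2 : x ^ 2 ≤ z ^ 2 := pow_le_pow_left₀ hx.1.le hx.2.le 2
  calc _ ≤ (ε * z ^ 2) * z := by
        refine mul_le_mul_of_nonneg_right (hb.trans ?_) hz0.le
        gcongr
    _ = _ := by ring

/-- A solution of the system with `φ → c₀ > 0` and `φ'' < 0` satisfies `φ' = -(N / c₀) z² + o(z²)`. -/
theorem asymptotics_near_zero {Φ P : ℝ → ℝ} {n N c₀ b : ℝ} (hn : 0 ≤ n) (hN : 0 < N)
    (hc₀ : 0 < c₀) (hb : 0 < b) (hlim : Tendsto Φ (𝓝[>] 0) (𝓝 c₀))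
    (hP : ∀ z ∈ Ioo 0 b, HasDerivAt P ((1 + P z ^ 2) * ((1 + n * z) / z ^ 2 * P z + N / Φ z)) z)
    (hG : ∀ z ∈ Ioo 0 b, (1 + n * z) / z ^ 2 * P z + N / Φ z < 0)
    {ε : ℝ} (hε : 0 < ε) :
    ∀ᶠ z in 𝓝[>] (0 : ℝ), |P z + N / c₀ * z ^ 2| ≤ ε * z ^ 2 := by
  set c := N / c₀
  have hcpos : 0 < c := div_pos hN hc₀
  have hlimN : Tendsto (fun z => N / Φ z) (𝓝[>] 0) (𝓝 c) := tendsto_const_nhds.div hlim hc₀.ne'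
  have hid : Tendsto (fun z : ℝ => z) (𝓝[>] 0) (𝓝 0) := tendsto_id.mono_left nhdsWithin_le_nhds
  -- upper bound, directly from the sign of the second derivative
  have hup : ∀ᶠ z in 𝓝[>] (0 : ℝ), P z + c * z ^ 2 ≤ ε * z ^ 2 := by
    have h1 : Tendsto (fun z => N / Φ z + -((c - ε) * n) * z) (𝓝[>] 0) (𝓝 c) := by
      simpa using hlimN.add (hid.const_mul (-((c - ε) * n)))
    filter_upwards [h1.eventually_const_lt (show c - ε < c by linarith),
      Ioo_mem_nhdsGT hb] with z h2 hz
    have hz0 := hz.1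
    have hg := hG z hz
    have hk : 0 < 1 + n * z := by nlinarith [mul_nonneg hn hz0.le]
    have e : (1 + n * z) / z ^ 2 * P z = (P z / z ^ 2) * (1 + n * z) := by ring
    rw [e] at hg
    have : P z / z ^ 2 ≤ - c + ε := by
      by_contra! hcon
      have := mul_lt_mul_of_pos_right hcon hk
      nlinarith
    rw [div_le_iff₀ (by positivity)] at this
    linarith
  -- lower bound
  have hlow : ∀ᶠ z in 𝓝[>] (0 : ℝ), -(c + ε) < P z / z ^ 2 := by
    have hev : ∀ᶠ z in 𝓝[>] (0 : ℝ), (z < b ∧ z < 1 / 2) ∧ N / Φ z < c + ε / 4 ∧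
        2 * (c + ε) * z < ε / 4 := by
      filter_upwards [Ioo_mem_nhdsGT hb, Ioo_mem_nhdsGT (show (0 : ℝ) < 1 / 2 by norm_num),
        hlimN.eventually_lt_const (show c < c + ε / 4 by linarith),
        (hid.const_mul (2 * (c + ε))).eventually_lt_const
          (show 2 * (c + ε) * 0 < ε / 4 by linarith)] with z h1 h2 h3 h4
      exact ⟨⟨h1.2, h2.2⟩, h3, h4⟩
    obtain ⟨δ, hδ, hsub⟩ := mem_nhdsGT_iff_exists_Ioo_subset.1 hev
    have hδ : 0 < δ := hδ
    have hq : ∀ z ∈ Ioo 0 δ, ∃ d, HasDerivAt (fun z => P z / z ^ 2) d z ∧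
        (P z / z ^ 2 ≤ -(c + ε) → d ≤ -(ε / 2) / z ^ 2) := by
      intro z hz
      obtain ⟨⟨h1, h2⟩, h3, h4⟩ := hsub hz
      have hz0 := hz.1
      refine ⟨_, (hP z ⟨hz0, h1⟩).div (hasDerivAt_pow 2 z) (by positivity), fun hle => ?_⟩
      set q := P z / z ^ 2 with hqdef
      have hPq : P z = q * z ^ 2 := by rw [hqdef]; field_simp
      set g := (1 + n * z) / z ^ 2 * P z + N / Φ z with hg
      have hg' : g = q * (1 + n * z) + N / Φ z := by rw [hg, hPq]; field_simp
      have hgneg : g < 0 := hG z ⟨hz0, h1⟩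
      have hgq : g ≤ q + c + ε / 4 := by
        rw [hg']; nlinarith [mul_nonneg hn hz0.le]
      rw [div_le_div_iff₀ (by positivity) (by positivity), hPq]
      have : (1 + (q * z ^ 2) ^ 2) * g - 2 * q * z ≤ -(ε / 2) := by
        nlinarith [mul_nonneg (sq_nonneg (q * z ^ 2)) (neg_nonneg.2 hgneg.le)]
      have h6 : 0 < z ^ 2 * z ^ 2 := by positivity
      have := mul_le_mul_of_nonneg_right this h6.le
      norm_num
      nlinarith
    obtain ⟨z₂, hz₂, hq₂⟩ : ∃ z ∈ Ioo 0 δ, -(c + ε) < P z / z ^ 2 := by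
      by_contra! hcon
      have hanti : AntitoneOn (fun z => P z / z ^ 2 - (ε / 2) * z⁻¹) (Ioo 0 δ) := by
        choose! d hd hd' using hq
        refine antitoneOn_of_hasDerivWithinAt_nonpos (convex_Ioo 0 δ)
          (f' := fun z => d z - (ε / 2) * (-(z ^ 2)⁻¹)) ?_ ?_ ?_
        · intro z hz
          exact ((hd z hz).continuousAt.sub
            ((continuousAt_inv₀ hz.1.ne').const_mul _)).continuousWithinAt
        · rw [interior_Ioo]
          intro z hz
          exact ((hd z hz).sub ((hasDerivAt_inv hz.1.ne').const_mul _)).hasDerivWithinAt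
        · rw [interior_Ioo]
          intro z hz
          have := hd' z hz (hcon z hz)
          have e : -(ε / 2) / z ^ 2 = (ε / 2) * (-(z ^ 2)⁻¹) := by ring
          rw [e] at this
          linarith
      have hm : δ / 2 ∈ Ioo 0 δ := ⟨by linarith, by linarith⟩
      have hinv : Tendsto (fun z : ℝ => P (δ / 2) / (δ / 2) ^ 2 - (ε / 2) * (δ / 2)⁻¹
          + (ε / 2) * z⁻¹) (𝓝[>] 0) atTop :=
        tendsto_atTop_add_const_left _ _ (tendsto_inv_nhdsGT_zero.const_mul_atTop (by linarith))
      obtain ⟨z, hz1, hz2⟩ := ((hinv.eventually_ge_atTop 0).and (Ioo_mem_nhdsGT hm.1)).exists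
      have hzδ : z ∈ Ioo 0 δ := ⟨hz2.1, hz2.2.trans hm.2⟩
      have h7 := hanti hzδ hm hz2.2.le
      have h8 := hcon z hzδ
      simp only at h7
      linarith
    have hneg : ∀ a ∈ Ioo 0 z₂, -(P a / a ^ 2 + (c + ε)) < 0 := by
      intro a ha
      have hs : ∀ z ∈ Icc a z₂, z ∈ Ioo 0 δ := fun z hz =>
        ⟨ha.1.trans_le hz.1, hz.2.trans_lt hz₂.2⟩
      refine neg_of_pos_hasDerivAt_at_zeros (f := fun z => -(P z / z ^ 2 + (c + ε))) (a := a)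
        (b := z₂) ?_ (by linarith) ?_ a ⟨le_rfl, ha.2⟩
      · intro z hz
        obtain ⟨d, hd, -⟩ := hq z (hs z hz)
        exact (hd.add_const (c + ε)).neg.continuousAt.continuousWithinAt
      · intro z hz h0 _
        obtain ⟨d, hd, hd'⟩ := hq z (hs z hz)
        refine ⟨-d, ?_, (hd.add_const (c + ε)).neg⟩
        have h1 := hd' (by linarith)
        have h2 : 0 < ε / 2 / z ^ 2 := div_pos (by linarith) (pow_pos (hs z hz).1 2)
        rw [neg_div] at h1
        linarith
    filter_upwards [Ioo_mem_nhdsGT hz₂.1] with z hz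
    linarith [hneg z hz]
  filter_upwards [hup, hlow, self_mem_nhdsWithin] with z h1 h2 h3
  have h3 : 0 < z := h3
  rw [lt_div_iff₀ (by positivity)] at h2
  rw [abs_le]
  constructor <;> linarith

/-- The first order system for `(φ, φ')` associated with the rotational soliton ODE (with
`N = n - 1`), where `φ'` is truncated to `[M, 0]` and `φ` is truncated to `[m, ∞)`. -/
noncomputable def truncField (n N M m t : ℝ) (x : ℝ × ℝ) : ℝ × ℝ :=
  (max M (min x.2 0), (1 + max M (min x.2 0) ^ 2) *
    ((1 + n * t) / t ^ 2 * max M (min x.2 0) + N / max x.1 m))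

theorem truncField_of_mem {n N M m t : ℝ} {x : ℝ × ℝ} (h1 : M ≤ x.2) (h2 : x.2 ≤ 0)
    (h3 : m ≤ x.1) :
    truncField n N M m t x = (x.2, (1 + x.2 ^ 2) * ((1 + n * t) / t ^ 2 * x.2 + N / x.1)) := by
  simp [truncField, h1, h2, h3]

theorem abs_trunc_le {M p : ℝ} (hM : M ≤ 0) : |max M (min p 0)| ≤ -M := by
  rw [abs_of_nonpos (max_le hM (min_le_right _ _))]
  exact neg_le_neg (le_max_left _ _)

theorem coeff_bound {n a b t : ℝ} (hn : 0 ≤ n) (ha : 0 < a) (ht : t ∈ Icc a b) :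
    |(1 + n * t) / t ^ 2| ≤ (1 + n * b) / a ^ 2 := by
  have ht0 : 0 < t := ha.trans_le ht.1
  rw [abs_of_nonneg (by positivity)]
  have := ht.1
  have := ht.2
  have : 0 ≤ b := ht0.le.trans ht.2
  gcongr

open scoped NNReal in
theorem truncField_bounded {n N M m a b : ℝ} (hn : 0 ≤ n) (hN : 0 ≤ N) (hM : M ≤ 0) (hm : 0 < m)
    (ha : 0 < a) :
    ∃ L : ℝ≥0, ∀ t ∈ Icc a b, ∀ x, ‖truncField n N M m t x‖ ≤ L := by
  set A := (1 + n * b) / a ^ 2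
  refine ⟨(max (-M) ((1 + (-M) ^ 2) * (A * (-M) + N / m))).toNNReal, fun t ht x => ?_⟩
  refine le_trans ?_ (Real.le_coe_toNNReal _)
  have hA : |(1 + n * t) / t ^ 2| ≤ A := coeff_bound hn ha ht
  have hu : |max M (min x.2 0)| ≤ -M := abs_trunc_le hM
  have hr : |N / max x.1 m| ≤ N / m := by
    have : m ≤ max x.1 m := le_max_right _ _
    have : 0 < max x.1 m := hm.trans_le this
    rw [abs_of_nonneg (by positivity)]
    gcongr
  rw [truncField, Prod.norm_mk]
  refine max_le_max hu ?_
  rw [norm_mul]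
  refine mul_le_mul ?_ ?_ (norm_nonneg _) (by positivity)
  · rw [Real.norm_eq_abs, abs_of_nonneg (by positivity), ← sq_abs]
    gcongr
  · refine (norm_add_le _ _).trans (add_le_add ?_ hr)
    rw [norm_mul]
    exact mul_le_mul hA hu (norm_nonneg _) ((abs_nonneg _).trans hA)

open scoped NNReal in
theorem truncField_lipschitz {n N M m a b : ℝ} (hn : 0 ≤ n) (hN : 0 ≤ N) (hM : M ≤ 0)
    (hm : 0 < m) (ha : 0 < a) :
    ∃ K : ℝ≥0, ∀ t ∈ Icc a b, LipschitzWith K (truncField n N M m t) := by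
  set A := (1 + n * b) / a ^ 2
  set B := -M
  refine ⟨(max 1 ((1 + B ^ 2) * (A + N / m ^ 2) + 2 * B * (A * B + N / m))).toNNReal,
    fun t ht => LipschitzWith.of_dist_le_mul fun x y => ?_⟩
  refine le_trans ?_ (mul_le_mul_of_nonneg_right (Real.le_coe_toNNReal _) dist_nonneg)
  have hA : |(1 + n * t) / t ^ 2| ≤ A := coeff_bound hn ha ht
  have hA0 : 0 ≤ A := (abs_nonneg _).trans hA
  have hB0 : 0 ≤ B := neg_nonneg.2 hM
  have hd1 : |x.1 - y.1| ≤ dist x y := le_max_left _ _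
  have hd2 : |x.2 - y.2| ≤ dist x y := le_max_right _ _
  set D := dist x y
  have hu : |max M (min x.2 0)| ≤ B := abs_trunc_le hM
  have hv : |max M (min y.2 0)| ≤ B := abs_trunc_le hM
  have huv : |max M (min x.2 0) - max M (min y.2 0)| ≤ D := by
    have h1 : |max M (min x.2 0) - max M (min y.2 0)| ≤ |min x.2 0 - min y.2 0| := by
      simpa using abs_max_sub_max_le_max M (min x.2 0) M (min y.2 0)
    have h2 : |min x.2 0 - min y.2 0| ≤ |x.2 - y.2| := by
      simpa using abs_min_sub_min_le_max x.2 0 y.2 0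
    exact h1.trans (h2.trans hd2)
  have hX : m ≤ max x.1 m := le_max_right _ _
  have hY : m ≤ max y.1 m := le_max_right _ _
  have hX0 : 0 < max x.1 m := hm.trans_le hX
  have hY0 : 0 < max y.1 m := hm.trans_le hY
  have hXY : |max x.1 m - max y.1 m| ≤ D := (abs_max_sub_max_le_abs _ _ _).trans hd1
  have hs : |N / max y.1 m| ≤ N / m := by
    rw [abs_of_nonneg (by positivity)]
    gcongr
  have hrs : |N / max x.1 m - N / max y.1 m| ≤ N / m ^ 2 * D := by
    have e : N / max x.1 m - N / max y.1 m =
        N / (max x.1 m * max y.1 m) * (max y.1 m - max x.1 m) := by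
      field_simp
    rw [e, abs_mul, abs_sub_comm (max y.1 m), abs_of_nonneg (by positivity), pow_two]
    gcongr
  rw [truncField, truncField, Prod.dist_eq, Real.dist_eq, Real.dist_eq,
    max_mul_of_nonneg _ _ dist_nonneg, one_mul]
  refine max_le_max huv ?_
  simp only
  set u := max M (min x.2 0)
  set w := max M (min y.2 0)
  set r := N / max x.1 m
  set s := N / max y.1 m
  set c := (1 + n * t) / t ^ 2
  have e : (1 + u ^ 2) * (c * u + r) - (1 + w ^ 2) * (c * w + s) =
      (1 + u ^ 2) * (c * (u - w) + (r - s)) + (u - w) * (u + w) * (c * w + s) := by ring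
  have hD0 : 0 ≤ D := dist_nonneg
  rw [e]
  have h1 : |(1 + u ^ 2) * (c * (u - w) + (r - s))| ≤ (1 + B ^ 2) * (A * D + N / m ^ 2 * D) := by
    rw [abs_mul]
    refine mul_le_mul ?_ ?_ (abs_nonneg _) (by positivity)
    · rw [abs_of_nonneg (by positivity), ← sq_abs]
      gcongr
    · refine (abs_add_le _ _).trans (add_le_add ?_ hrs)
      rw [abs_mul]
      exact mul_le_mul hA huv (abs_nonneg _) hA0
  have h2 : |(u - w) * (u + w) * (c * w + s)| ≤ D * (B + B) * (A * B + N / m) := by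
    rw [abs_mul, abs_mul]
    refine mul_le_mul (mul_le_mul huv ((abs_add_le _ _).trans (add_le_add hu hv)) (abs_nonneg _)
      hD0) ((abs_add_le _ _).trans (add_le_add ?_ hs)) (abs_nonneg _) (by positivity)
    rw [abs_mul]
    exact mul_le_mul hA hv (abs_nonneg _) hA0
  refine (abs_add_le _ _).trans ((add_le_add h1 h2).trans (le_of_eq ?_))
  ring

theorem truncField_continuousOn (n N M m : ℝ) (x : ℝ × ℝ) :
    ContinuousOn (fun t => truncField n N M m t x) (Ioi 0) := by
  intro t ht
  have ht : t ≠ 0 := (show (0 : ℝ) < t from ht).ne'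
  refine ContinuousAt.continuousWithinAt ?_
  unfold truncField
  fun_prop (disch := positivity)

/-- Going backward from a point `z₀` where `φ' < 0` and `φ'' ≤ 0`, a solution of the truncated
system stays inside the region where the truncation is inactive, and is strictly concave. -/
theorem truncField_concave {Φ P : ℝ → ℝ} {n N M m z₀ : ℝ} (hn : 0 ≤ n) (hN : 0 < N) (hm : 0 < m)
    (hM : M < P z₀) (hP₀ : P z₀ < 0) (hΦ₀ : m < Φ z₀)
    (hΦ : ∀ z > 0, HasDerivAt Φ (truncField n N M m z (Φ z, P z)).1 z)
    (hP : ∀ z > 0, HasDerivAt P (truncField n N M m z (Φ z, P z)).2 z)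
    (hz₀ : 0 < z₀) (hG₀ : (1 + n * z₀) / z₀ ^ 2 * P z₀ + N / Φ z₀ ≤ 0) :
    ∀ z ∈ Ioo 0 z₀, M < P z ∧ P z < 0 ∧ m < Φ z ∧
      (1 + n * z) / z ^ 2 * P z + N / Φ z < 0 := by
  have hM0 : M ≤ 0 := (hM.trans hP₀).le
  have hanti : AntitoneOn Φ (Ioi 0) := by
    refine antitoneOn_of_hasDerivWithinAt_nonpos (convex_Ioi 0)
      (fun z hz => (hΦ z hz).continuousAt.continuousWithinAt)
      (fun z hz => (hΦ z (interior_subset hz)).hasDerivWithinAt) (fun z _ => ?_)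
    exact max_le hM0 (min_le_right _ _)
  have hΦm : ∀ z ∈ Ioc 0 z₀, m < Φ z := fun z hz => hΦ₀.trans_le (hanti hz.1 hz₀ hz.2)
  set G : ℝ → ℝ := fun z =>
    (1 + n * z) / z ^ 2 * max M (min (P z) 0) + N / max (Φ z) m with hGdef
  have hPanti : ∀ x ∈ Ioc 0 z₀, (∀ y ∈ Ioo x z₀, G y < 0) → P z₀ ≤ P x := by
    intro x hx hneg
    have : AntitoneOn P (Icc x z₀) := by
      refine antitoneOn_of_hasDerivWithinAt_nonpos (convex_Icc x z₀)
        (fun z hz => (hP z (hx.1.trans_le hz.1)).continuousAt.continuousWithinAt)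
        (fun z hz => (hP z (hx.1.trans_le (interior_subset hz).1)).hasDerivWithinAt)
        (fun z hz => ?_)
      rw [interior_Icc] at hz
      exact mul_nonpos_of_nonneg_of_nonpos (by positivity) (hneg z hz).le
    exact this ⟨le_rfl, hx.2⟩ ⟨hx.2, le_rfl⟩ hx.2
  have hPneg : ∀ x > 0, G x ≤ 0 → P x < 0 := by
    intro x hx hG
    by_contra! h0
    have h1 : max M (min (P x) 0) = 0 := by rw [min_eq_right h0, max_eq_right hM0]
    have h2 : 0 < N / max (Φ x) m := div_pos hN (lt_max_of_lt_right hm)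
    simp only [hGdef, h1, mul_zero, zero_add] at hG
    exact absurd hG (not_le.2 h2)
  have hGeq : ∀ x, M ≤ P x → P x ≤ 0 → m ≤ Φ x →
      G x = (1 + n * x) / x ^ 2 * P x + N / Φ x := by
    intro x h1 h2 h3
    simp only [hGdef, min_eq_left h2, max_eq_right h1, max_eq_left h3]
  have hGneg : ∀ a ∈ Ioo 0 z₀, G a < 0 := by
    intro a ha
    refine neg_of_pos_hasDerivAt_at_zeros (a := a) (b := z₀) ?_ ?_ ?_ a ⟨le_rfl, ha.2⟩
    · intro z hz
      have hz0 : 0 < z := ha.1.trans_le hz.1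
      have c1 := (hΦ z hz0).continuousAt
      have c2 := (hP z hz0).continuousAt
      have hne : max (Φ z) m ≠ 0 := (lt_max_of_lt_right hm).ne'
      refine ContinuousAt.continuousWithinAt ?_
      fun_prop (disch := first | assumption | positivity)
    · rw [hGeq z₀ hM.le hP₀.le hΦ₀.le]
      exact hG₀
    · intro x hx hGx hneg
      have hx0 : 0 < x := ha.1.trans_le hx.1
      have hPM : M < P x := hM.trans_le (hPanti x ⟨hx0, hx.2⟩ hneg)
      have hPx : P x < 0 := hPneg x hx0 hGx.le
      have hΦx : m < Φ x := hΦm x ⟨hx0, hx.2⟩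
      have hΦ0 : 0 < Φ x := hm.trans hΦx
      have dΦ := hΦ x hx0
      have dP := hP x hx0
      have hG1 := hGeq x hPM.le hPx.le hΦx.le
      rw [truncField_of_mem hPM.le hPx.le hΦx.le] at dΦ dP
      simp only [← hG1, hGx, mul_zero] at dP
      simp only at dΦ
      have dA : HasDerivAt (fun z : ℝ => (1 + n * z) / z ^ 2) (-(n * x + 2) / x ^ 3) x := by
        have := (((hasDerivAt_id x).const_mul n).const_add 1).div (hasDerivAt_pow 2 x)
          (by positivity)
        refine this.congr_deriv ?_
        simp only [id]
        field_simp
        norm_num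
        ring
      have dG := (dA.mul dP).add ((hasDerivAt_const x N).div dΦ hΦ0.ne')
      refine ⟨_, ?_, dG.congr_of_eventuallyEq ?_⟩
      · have e : -(n * x + 2) / x ^ 3 * P x + (1 + n * x) / x ^ 2 * 0 +
            (0 * Φ x - N * P x) / Φ x ^ 2 =
            ((n * x + 2) / x ^ 3 + N / Φ x ^ 2) * (-P x) := by ring
        rw [e]
        have : 0 < -P x := neg_pos.2 hPx
        positivity
      · have hΦc := (hΦ x hx0).continuousAt
        have hPc := (hP x hx0).continuousAt
        filter_upwards [hΦc.eventually_const_lt hΦx, hPc.eventually_const_lt hPM,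
          hPc.eventually_lt_const hPx] with t h1 h2 h3
        exact hGeq t h2.le h3.le h1.le
  intro z hz
  have h1 := hPneg z hz.1 (hGneg z hz).le
  have h2 := hM.trans_le (hPanti z ⟨hz.1, hz.2.le⟩ fun y hy => hGneg y ⟨hz.1.trans hy.1, hy.2⟩)
  have h3 := hΦm z ⟨hz.1, hz.2.le⟩
  exact ⟨h2, h1, h3, hGeq z h2.le h1.le h3.le ▸ hGneg z hz⟩

theorem ContDiffAt.hasDerivAt_deriv_of_two {φ : ℝ → ℝ} {z : ℝ} (h : ContDiffAt ℝ 2 φ z) :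
    HasDerivAt φ (deriv φ z) z ∧ HasDerivAt (deriv φ) (deriv (deriv φ) z) z := by
  have h1 : ContDiffAt ℝ 1 (deriv φ) z := by
    simpa only [fderiv_apply_one_eq_deriv] using
      (h.fderiv_right (m := 1) (by norm_num)).clm_apply (contDiffAt_const (c := (1 : ℝ)))
  exact ⟨(h.differentiableAt (by norm_num)).hasDerivAt,
    (h1.differentiableAt (by norm_num)).hasDerivAt⟩

theorem rotODE_iff {n : ℕ} {φ : ℝ → ℝ} {z : ℝ} (hz : 0 < z) :
    RotODE n φ z ↔ deriv (deriv φ) z = (1 + deriv φ z ^ 2) *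
      ((1 + (n : ℝ) * z) / z ^ 2 * deriv φ z + ((n : ℝ) - 1) / φ z) := by
  have h1 : (1 + deriv φ z ^ 2) ≠ 0 := by positivity
  have e : z * deriv (deriv φ) z / (1 + (deriv φ z) ^ 2) -
      ((1 + (n : ℝ) * z) / z) * deriv φ z - ((n : ℝ) - 1) * z / φ z =
      z / (1 + (deriv φ z) ^ 2) * (deriv (deriv φ) z - (1 + deriv φ z ^ 2) *
      ((1 + (n : ℝ) * z) / z ^ 2 * deriv φ z + ((n : ℝ) - 1) / φ z)) := by
    rw [mul_sub, ← mul_assoc, div_mul_cancel₀ _ h1]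
    field_simp
    ring
  rw [RotODE, e, mul_eq_zero, sub_eq_zero]
  exact or_iff_right (div_ne_zero hz.ne' h1)

theorem contDiffAt_two_of_hasDerivAt {ψ p p' : ℝ → ℝ} {s : Set ℝ} {z : ℝ} (hs : IsOpen s)
    (hz : z ∈ s) (h1 : ∀ t ∈ s, HasDerivAt ψ (p t) t) (h2 : ∀ t ∈ s, HasDerivAt p (p' t) t)
    (h3 : ContinuousOn p' s) :
    ContDiffAt ℝ 2 ψ z := by
  have hd1 : EqOn (deriv ψ) p s := fun t ht => (h1 t ht).deriv
  have hd2 : EqOn (deriv p) p' s := fun t ht => (h2 t ht).deriv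
  have c1 : ContDiffOn ℝ 1 p s := by
    rw [show (1 : WithTop ℕ∞) = 0 + 1 by norm_num, contDiffOn_succ_iff_deriv_of_isOpen hs]
    exact ⟨fun t ht => (h2 t ht).differentiableAt.differentiableWithinAt, by simp,
      (contDiffOn_zero.2 h3).congr hd2⟩
  have c2 : ContDiffOn ℝ 2 ψ s := by
    rw [show (2 : WithTop ℕ∞) = 1 + 1 by norm_num, contDiffOn_succ_iff_deriv_of_isOpen hs]
    exact ⟨fun t ht => (h1 t ht).differentiableAt.differentiableWithinAt, by simp, c1.congr hd1⟩
  exact c2.contDiffAt (hs.mem_nhds hz)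

/-- concave branch, Lemma 3.6(1): a positive solution of the rotational
soliton ODE near `z₀ > 0` with `φ'(z₀) < 0` and `φ''(z₀) ≤ 0` extends to a positive
solution on `(0,z₀]` with `φ' < 0`, `φ'' < 0` on `(0,z₀)`, which is `C¹` up to `0` with
`φ(0) > 0`, `φ'(0) = 0`, and `φ(z) = φ(0) − ((n−1)/(3φ(0)))z³ + o(z³)` as `z → 0⁺`. -/
theorem rot_soliton_concave_branch (n : ℕ) (hn : 2 ≤ n) (z₀ : ℝ) (hz₀ : 0 < z₀)
    (φ : ℝ → ℝ)
    (hnb : ∀ᶠ z in 𝓝 z₀, ContDiffAt ℝ 2 φ z ∧ 0 < φ z ∧ RotODE n φ z)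
    (hd : deriv φ z₀ < 0) (hdd : deriv (deriv φ) z₀ ≤ 0) :
    ∃ ψ : ℝ → ℝ, ψ =ᶠ[𝓝 z₀] φ ∧
      (∀ z ∈ Set.Ioc 0 z₀, ContDiffAt ℝ 2 ψ z ∧ 0 < ψ z ∧ RotODE n ψ z) ∧
      (∀ z ∈ Set.Ioo 0 z₀, deriv ψ z < 0 ∧ deriv (deriv ψ) z < 0) ∧
      ContinuousOn ψ (Set.Icc 0 z₀) ∧ 0 < ψ 0 ∧
      HasDerivWithinAt ψ 0 (Set.Ici 0) 0 ∧
      (fun z => ψ z - (ψ 0 - ((n : ℝ) - 1) / (3 * ψ 0) * z ^ 3)) =o[𝓝[>] (0 : ℝ)]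
        fun z => z ^ 3 := by
  have hn0 : (0 : ℝ) ≤ n := Nat.cast_nonneg n
  have hN : (0 : ℝ) < (n : ℝ) - 1 := by
    have : (2 : ℝ) ≤ n := by exact_mod_cast hn
    linarith
  obtain ⟨hC₀, hφ₀, hODE₀⟩ := hnb.self_of_nhds
  obtain ⟨dφ₀, dφ₀'⟩ := hC₀.hasDerivAt_deriv_of_two
  set M := 2 * deriv φ z₀ with hMdef
  set m := φ z₀ / 2 with hmdef
  have hM : M < deriv φ z₀ := by linarith
  have hM0 : M ≤ 0 := by linarith
  have hm : 0 < m := by positivity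
  have hmφ : m < φ z₀ := by linarith
  obtain ⟨α, hα₀, hα⟩ := exists_forall_pos_hasDerivAt (v := truncField n ((n : ℝ) - 1) M m) hz₀
    (φ z₀, deriv φ z₀) (fun a b ha => truncField_lipschitz hn0 hN.le hM0 hm ha)
    (fun a b ha => truncField_bounded hn0 hN.le hM0 hm ha) (truncField_continuousOn _ _ _ _)
  set Φ : ℝ → ℝ := fun z => (α z).1 with hΦdef
  set P : ℝ → ℝ := fun z => (α z).2 with hPdef
  have hΦ : ∀ z > 0, HasDerivAt Φ (truncField n ((n : ℝ) - 1) M m z (Φ z, P z)).1 z :=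
    fun z hz => (hα z hz).fst
  have hP : ∀ z > 0, HasDerivAt P (truncField n ((n : ℝ) - 1) M m z (Φ z, P z)).2 z :=
    fun z hz => (hα z hz).snd
  have hΦ₀ : Φ z₀ = φ z₀ := by simp [hΦdef, hα₀]
  have hP₀ : P z₀ = deriv φ z₀ := by simp [hPdef, hα₀]
  have hαφ : Φ =ᶠ[𝓝 z₀] φ := by
    obtain ⟨K, hK⟩ := truncField_lipschitz (m := m) (M := M) (a := z₀ / 2) (b := z₀ + 1)
      hn0 hN.le hM0 hm (by positivity)
    have hmem : Ioo (z₀ / 2) (z₀ + 1) ∈ 𝓝 z₀ := Ioo_mem_nhds (by linarith) (by linarith)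
    have := ODE_solution_unique_of_eventually (v := truncField n ((n : ℝ) - 1) M m)
      (s := fun _ => univ) (K := K) (f := α) (g := fun z => (φ z, deriv φ z)) (t₀ := z₀)
      (by
        filter_upwards [hmem] with t ht using (hK t ⟨ht.1.le, ht.2.le⟩).lipschitzOnWith)
      (by
        filter_upwards [eventually_gt_nhds hz₀] with t ht using ⟨hα t ht, mem_univ _⟩)
      (by
        filter_upwards [eventually_gt_nhds hz₀, hnb, dφ₀.continuousAt.eventually_const_lt hmφ,
          dφ₀'.continuousAt.eventually_const_lt hM,
          dφ₀'.continuousAt.eventually_lt_const hd] with t ht ⟨hC, _, hO⟩ h1 h2 h3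
        refine ⟨?_, mem_univ _⟩
        rw [truncField_of_mem h2.le h3.le h1.le]
        obtain ⟨d1, d2⟩ := hC.hasDerivAt_deriv_of_two
        simp only
        rw [← (rotODE_iff ht).1 hO]
        exact d1.prodMk d2) hα₀
    filter_upwards [this] with t ht
    simp [hΦdef, ht]
  have hconc : ∀ z ∈ Ioo 0 z₀, M < P z ∧ P z < 0 ∧ m < Φ z ∧
      (1 + n * z) / z ^ 2 * P z + ((n : ℝ) - 1) / Φ z < 0 := by
    refine truncField_concave hn0 hN hm (by rwa [hP₀]) (by rwa [hP₀]) (by rwa [hΦ₀]) hΦ hP hz₀ ?_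
    rw [hΦ₀, hP₀]
    rw [rotODE_iff hz₀] at hODE₀
    rw [hODE₀] at hdd
    exact nonpos_of_mul_nonpos_right hdd (by positivity)
  have hΦ' : ∀ z ∈ Ioo 0 z₀, HasDerivAt Φ (P z) z := fun z hz => by
    obtain ⟨h1, h2, h3, -⟩ := hconc z hz
    have := hΦ z hz.1
    rwa [truncField_of_mem h1.le h2.le h3.le] at this
  have hP' : ∀ z ∈ Ioo 0 z₀, HasDerivAt P ((1 + P z ^ 2) *
      ((1 + n * z) / z ^ 2 * P z + ((n : ℝ) - 1) / Φ z)) z := fun z hz => by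
    obtain ⟨h1, h2, h3, -⟩ := hconc z hz
    have := hP z hz.1
    rwa [truncField_of_mem h1.le h2.le h3.le] at this
  have hanti : AntitoneOn Φ (Ioi 0) :=
    antitoneOn_of_hasDerivWithinAt_nonpos (convex_Ioi 0)
      (fun z hz => (hΦ z hz).continuousAt.continuousWithinAt)
      (fun z hz => (hΦ z (interior_subset hz)).hasDerivWithinAt)
      (fun z _ => max_le hM0 (min_le_right _ _))
  have hbdd : ∀ z ∈ Ioi (0 : ℝ), Φ z ≤ Φ z₀ + -M * z₀ := by
    intro z hz
    have hz : 0 < z := hz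
    have hpos : 0 ≤ -M * z₀ := mul_nonneg (neg_nonneg.2 hM0) hz₀.le
    rcases le_or_gt z₀ z with h | h
    · linarith [hanti hz₀ hz h]
    · obtain ⟨x, hx, hxe⟩ := exists_hasDerivAt_eq_slope Φ P h
        (fun t ht => (hΦ t (hz.trans_le ht.1)).continuousAt.continuousWithinAt)
        (fun t ht => hΦ' t ⟨hz.trans ht.1, ht.2⟩)
      have h1 := (hconc x ⟨hz.trans hx.1, hx.2⟩).1
      rw [hxe, lt_div_iff₀ (sub_pos.2 h)] at h1
      nlinarith
  set c₀ := sSup (Φ '' Ioi 0)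
  have hBA : BddAbove (Φ '' Ioi 0) := ⟨_, forall_mem_image.2 hbdd⟩
  have hlim : Tendsto Φ (𝓝[>] 0) (𝓝 c₀) := hanti.tendsto_nhdsGT hBA
  have hc₀ : 0 < c₀ := by
    have : Φ z₀ ≤ c₀ := le_csSup hBA (mem_image_of_mem Φ hz₀)
    linarith
  set ψ : ℝ → ℝ := Function.update Φ 0 c₀
  have hψ0 : ψ 0 = c₀ := Function.update_self ..
  have hψΦ : ∀ z ∈ Ioi (0 : ℝ), ψ z = Φ z := fun z hz =>
    Function.update_of_ne (show (0 : ℝ) < z from hz).ne' _ _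
  have hψev : ∀ z > 0, ψ =ᶠ[𝓝 z] Φ := fun z hz => by
    filter_upwards [eventually_gt_nhds hz] with t ht using hψΦ t ht
  have hψφ : ψ =ᶠ[𝓝 z₀] φ := (hψev z₀ hz₀).trans hαφ
  have hψ' : ∀ z ∈ Ioo 0 z₀, HasDerivAt ψ (P z) z := fun z hz =>
    (hΦ' z hz).congr_of_eventuallyEq (hψev z hz.1)
  have hderiv : ∀ z ∈ Ioo 0 z₀, deriv (deriv ψ) z = (1 + P z ^ 2) *
      ((1 + n * z) / z ^ 2 * P z + ((n : ℝ) - 1) / Φ z) := fun z hz => by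
    have : deriv ψ =ᶠ[𝓝 z] P := by
      filter_upwards [isOpen_Ioo.mem_nhds hz] with t ht using (hψ' t ht).deriv
    rw [this.deriv_eq, (hP' z hz).deriv]
  have hcwa : ContinuousWithinAt ψ (Ici 0) 0 := by
    rw [← continuousWithinAt_Ioi_iff_Ici, ContinuousWithinAt, hψ0]
    refine hlim.congr' ?_
    filter_upwards [self_mem_nhdsWithin] with z hz using (hψΦ z hz).symm
  have hexp : (fun z => ψ z - (ψ 0 - ((n : ℝ) - 1) / (3 * ψ 0) * z ^ 3)) =o[𝓝[>] (0 : ℝ)]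
      fun z => z ^ 3 := by
    have e : ((n : ℝ) - 1) / (3 * ψ 0) = ((n : ℝ) - 1) / c₀ / 3 := by rw [hψ0]; field_simp
    rw [e]
    refine isLittleO_cube_of_hasDerivAt (p := P) hcwa ?_ fun ε hε =>
      asymptotics_near_zero hn0 hN hc₀ hz₀ hlim hP' (fun z hz => (hconc z hz).2.2.2) hε
    filter_upwards [Ioo_mem_nhdsGT hz₀] with z hz using hψ' z hz
  refine ⟨ψ, hψφ, ?_, ?_, ?_, hψ0 ▸ hc₀, ?_, hexp⟩
  · rintro z ⟨hz0, hz⟩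
    rcases hz.eq_or_lt with rfl | hz
    · refine ⟨hC₀.congr_of_eventuallyEq hψφ, ?_, ?_⟩
      · rwa [hψφ.eq_of_nhds]
      · rw [RotODE, hψφ.deriv.deriv_eq, hψφ.deriv_eq, hψφ.eq_of_nhds]
        exact hODE₀
    · have hzm : z ∈ Ioo 0 z₀ := ⟨hz0, hz⟩
      refine ⟨?_, ?_, ?_⟩
      · refine contDiffAt_two_of_hasDerivAt isOpen_Ioo hzm hψ' hP' fun t ht => ?_
        have c1 := (hΦ' t ht).continuousAt
        have c2 := (hP' t ht).continuousAt
        have h1 : Φ t ≠ 0 := (hm.trans (hconc t ht).2.2.1).ne'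
        have h2 : t ≠ 0 := ht.1.ne'
        refine ContinuousAt.continuousWithinAt ?_
        fun_prop (disch := first | assumption | positivity)
      · rw [hψΦ z hz0]
        exact hm.trans (hconc z hzm).2.2.1
      · rw [rotODE_iff hz0, hderiv z hzm, (hψ' z hzm).deriv, hψΦ z hz0]
  · intro z hz
    rw [hderiv z hz, (hψ' z hz).deriv]
    exact ⟨(hconc z hz).2.1, mul_neg_of_pos_of_neg (by positivity) (hconc z hz).2.2.2⟩
  · intro z hz
    rcases hz.1.eq_or_lt with rfl | hz0
    · exact hcwa.mono Icc_subset_Ici_self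
    · exact ((hΦ z hz0).continuousAt.congr (hψev z hz0).symm).continuousWithinAt
  · rw [← hasDerivWithinAt_Ioi_iff_Ici, hasDerivWithinAt_iff_isLittleO]
    have hcube : (fun z : ℝ => z ^ 3) =o[𝓝[>] (0 : ℝ)] fun z => z := by
      have := (isLittleO_pow_pow (𝕜 := ℝ) (show 1 < 3 by norm_num)).mono
        (nhdsWithin_le_nhds (s := Ioi (0 : ℝ)))
      simpa using this
    have := (hexp.trans hcube).sub (hcube.const_mul_left (((n : ℝ) - 1) / (3 * ψ 0)))
    refine this.congr (fun z => ?_) fun z => ?_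
    · simp; ring
    · simp
end
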